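/- arXiv:2505.09804 — 5 statements merged into one kernel-verified Lean document; each statement's English description precedes it below -/
import Mathlib

section
/- Let n ≥ 1. The set Ω_{n,K}(ℙ¹;S) decomposes into finitely many orbits under the action of GL₂(O_{K,S}): there exist finitely many sets A₁,…,A_M ∈ Ω_{n,K}(ℙ¹;S) such that every A ∈ Ω_{n,K}(ℙ¹;S) satisfies A = γ·A_i for some γ ∈ GL₂(O_{K,S}) and some i. -/
open Classical IsDedekindDomain NumberField
open scoped LinearAlgebra.Projectivization MatrixGroups

attribute [local instance] Ideal.Quotient.field

set_option synthInstance.maxHeartbeats 1000000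
set_option maxHeartbeats 1000000

noncomputable instance projLineNonempty (F : Type*) [Field F] :
    Nonempty (ℙ F (Fin 2 → F)) :=
  ⟨Projectivization.mk F ![1, 0] (by
    intro h
    have := congrFun h 0
    simp at this)⟩

variable {K : Type*} [Field K] [NumberField K]

/-- The reduction map `ℙ¹(K) → ℙ¹(𝒪_K/𝔭)` at a maximal ideal `𝔭 = v.asIdeal`:
a point is represented by a pair of integers, not both in `𝔭`, and reduced
coordinatewise. -/
noncomputable def redMap (v : HeightOneSpectrum (𝓞 K)) (x : ℙ K (Fin 2 → K)) :
    ℙ (𝓞 K ⧸ v.asIdeal) (Fin 2 → 𝓞 K ⧸ v.asIdeal) :=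
  if h : ∃ y : ℙ (𝓞 K ⧸ v.asIdeal) (Fin 2 → 𝓞 K ⧸ v.asIdeal),
      ∃ (w : Fin 2 → 𝓞 K) (hw : (fun i => algebraMap (𝓞 K) K (w i)) ≠ 0)
        (hw' : (fun i => Ideal.Quotient.mk v.asIdeal (w i)) ≠ 0),
      x = Projectivization.mk K (fun i => algebraMap (𝓞 K) K (w i)) hw ∧
      y = Projectivization.mk (𝓞 K ⧸ v.asIdeal) (fun i => Ideal.Quotient.mk v.asIdeal (w i)) hw'
  then h.choose
  else Classical.arbitrary _

/-- `Ω_{n,K}(ℙ¹;S)`: `n`-element subsets of `ℙ¹(K)` on which reduction at every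
prime outside `S` is injective. -/
noncomputable def OmegaSet (S : Finset (HeightOneSpectrum (𝓞 K))) (n : ℕ) :
    Set (Set (ℙ K (Fin 2 → K))) :=
  {A | A.Finite ∧ A.ncard = n ∧
    ∀ v : HeightOneSpectrum (𝓞 K), v ∉ S → Set.InjOn (redMap v) A}

/-- The action of `GL₂(F)` on `ℙ¹(F)`, `[α:β] ↦ [(α,β)γ]`. -/
noncomputable def glPt {F : Type*} [Field F] (g : GL (Fin 2) F) (x : ℙ F (Fin 2 → F)) :
    ℙ F (Fin 2 → F) :=
  Projectivization.mk F (Matrix.vecMul x.rep (g : Matrix (Fin 2) (Fin 2) F)) (by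
    intro h0
    apply x.rep_nonzero
    have h2 := congrArg
      (fun u => Matrix.vecMul u ((g⁻¹ : GL (Fin 2) F) : Matrix (Fin 2) (Fin 2) F)) h0
    simp only [Matrix.vecMul_vecMul, Matrix.zero_vecMul] at h2
    rwa [← Units.val_mul, mul_inv_cancel, Units.val_one, Matrix.vecMul_one] at h2)

section Pade

open Polynomial

/-- denominators of the Padé approximants to `(1 - X) ^ (a + b + 1)` -/
noncomputable def padeDenom (a b : ℕ) : ℤ[X] :=
  ∑ j ∈ Finset.range (a + 1), C (((j + a).choose a * (a - j + b).choose b : ℕ) : ℤ) * X ^ j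

/-- A polynomial interpolating the coefficients of `padeDenom a b`, up to the factor `a! * b!`. -/
noncomputable def padeInterp (a b : ℕ) : ℤ[X] :=
  (∏ i ∈ Finset.range a, (X + C ((i : ℤ) + 1))) * ∏ i ∈ Finset.range b, (C ((a : ℤ) + 1 + i) - X)

lemma padeDenom_coeff (a b j : ℕ) : (padeDenom a b).coeff j =
    if j ≤ a then (((j + a).choose a * (a - j + b).choose b : ℕ) : ℤ) else 0 := by
  simp only [padeDenom, finsetSum_coeff, coeff_C_mul_X_pow]
  simp

lemma padeInterp_natDegree (a b : ℕ) : (padeInterp a b).natDegree < a + b + 1 := by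
  have h1 : (∏ i ∈ Finset.range a, (X + C ((i : ℤ) + 1))).natDegree ≤ a := by
    refine (natDegree_prod_le _ _).trans ?_
    refine (Finset.sum_le_sum (g := fun _ => 1) fun i _ => ?_).trans (by simp)
    exact (natDegree_X_add_C _).le
  have h2 : (∏ i ∈ Finset.range b, (C ((a : ℤ) + 1 + i) - X)).natDegree ≤ b := by
    refine (natDegree_prod_le _ _).trans ?_
    refine (Finset.sum_le_sum (g := fun _ => 1) fun i _ => ?_).trans (by simp)
    exact (natDegree_sub_le _ _).trans (by rw [natDegree_C, natDegree_X]; simp)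
  exact Nat.lt_succ_of_le (natDegree_mul_le.trans (add_le_add h1 h2))

lemma padeInterp_eval_natCast {a b j : ℕ} (hj : j ≤ a + b) :
    (padeInterp a b).eval (j : ℤ) = a.factorial * b.factorial * (padeDenom a b).coeff j := by
  rw [padeDenom_coeff, padeInterp, eval_mul, eval_prod, eval_prod]
  split_ifs with h
  · have h1 : ∏ i ∈ Finset.range a, eval (j : ℤ) (X + C ((i : ℤ) + 1)) =
        (a.factorial * (j + a).choose a : ℕ) := by
      rw [← Nat.ascFactorial_eq_factorial_mul_choose, Nat.ascFactorial_eq_prod_range]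
      push_cast
      refine Finset.prod_congr rfl fun i _ => ?_
      simp; ring
    have h2 : ∏ i ∈ Finset.range b, eval (j : ℤ) (C ((a : ℤ) + 1 + i) - X) =
        (b.factorial * (a - j + b).choose b : ℕ) := by
      rw [← Nat.ascFactorial_eq_factorial_mul_choose, Nat.ascFactorial_eq_prod_range]
      push_cast [h]
      refine Finset.prod_congr rfl fun i _ => ?_
      simp; ring
    rw [h1, h2]; push_cast; ring
  · rw [Finset.prod_eq_zero (s := Finset.range b) (i := j - a - 1)]
    · simp
    · simp; omega
    · have : ((j - a - 1 : ℕ) : ℤ) = j - a - 1 := by omega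
      simp [this]

lemma padeInterp_eval_neg {a b i : ℕ} (hi : i < a) :
    (padeInterp a b).eval (-(i + 1 : ℤ)) = 0 := by
  rw [padeInterp, eval_mul, eval_prod, Finset.prod_eq_zero (Finset.mem_range.2 hi), zero_mul]
  simp

lemma padeInterp_eval_neg_ne_zero (a b : ℕ) : (padeInterp a b).eval (-(a + 1 : ℤ)) ≠ 0 := by
  rw [padeInterp, eval_mul, eval_prod, eval_prod]
  refine mul_ne_zero (Finset.prod_ne_zero_iff.2 fun i hi => ?_)
    (Finset.prod_ne_zero_iff.2 fun i hi => ?_)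
  · rw [Finset.mem_range] at hi
    simp; omega
  · simp; omega

lemma coeff_one_sub_X_pow (m i : ℕ) : ((1 - X : ℤ[X]) ^ m).coeff i = (-1) ^ i * m.choose i := by
  have : (1 - X : ℤ[X]) ^ m = ((1 + X) ^ m : ℤ[X]).comp (C (-1) * X) := by simp [sub_eq_add_neg]
  rw [this, comp_C_mul_X_coeff, coeff_one_add_X_pow, mul_comm]

lemma coeff_one_sub_X_pow_mul_padeDenom {a b k : ℕ} (hk : k ≤ a + b) :
    (a.factorial * b.factorial : ℤ) * ((1 - X) ^ (a + b + 1) * padeDenom a b).coeff k =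
    - ∑ i ∈ Finset.Ico (k + 1) (a + b + 2),
      (-1) ^ i * ((a + b + 1).choose i : ℤ) * (padeInterp a b).eval ((k : ℤ) - i) := by
  have key : ∑ i ∈ Finset.range (a + b + 2),
      (-1) ^ i * ((a + b + 1).choose i : ℤ) * (padeInterp a b).eval ((k : ℤ) - i) = 0 := by
    have h0 := congrFun (fwdDiff_iter_eq_zero_of_degree_lt (padeInterp_natDegree a b))
      ((k : ℤ) - (a + b + 1 : ℕ))
    rw [fwdDiff_iter_eq_sum_shift, ← Finset.sum_range_reflect] at h0
    rw [← Pi.zero_apply (M := fun _ : ℤ => ℤ) ((k : ℤ) - (a + b + 1 : ℕ)), ← h0]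
    refine Finset.sum_congr rfl fun i hi => ?_
    rw [Finset.mem_range] at hi
    have h1 : a + b + 1 + 1 - 1 - i = a + b + 1 - i := by omega
    have h2 : a + b + 1 - (a + b + 1 - i) = i := by omega
    have h3 : ((a + b + 1 - i : ℕ) : ℤ) = (a + b + 1 : ℕ) - i := by omega
    rw [h1, h2, Nat.choose_symm (by omega), nsmul_one, h3,
      smul_eq_mul]
    congr 2
    ring
  rw [← Finset.sum_range_add_sum_Ico _ (show k + 1 ≤ a + b + 2 by omega)] at key
  rw [eq_neg_iff_add_eq_zero, ← key, coeff_mul, Finset.Nat.sum_antidiagonal_eq_sum_range_succ_mk,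
    Finset.mul_sum]
  congr 1
  refine Finset.sum_congr rfl fun i hi => ?_
  rw [Finset.mem_range] at hi
  have h3 : (k : ℤ) - i = (k - i : ℕ) := by omega
  rw [h3, padeInterp_eval_natCast (by omega), coeff_one_sub_X_pow]
  ring

lemma coeff_padeNumer_eq_zero {a b k : ℕ} (hb : b < k) (hk : k ≤ a + b) :
    ((1 - X) ^ (a + b + 1) * padeDenom a b).coeff k = 0 := by
  have h := coeff_one_sub_X_pow_mul_padeDenom hk
  rw [Finset.sum_eq_zero, neg_zero] at h
  · exact (mul_eq_zero.1 h).resolve_left (by positivity)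
  · intro i hi
    rw [Finset.mem_Ico] at hi
    have : (k : ℤ) - i = -((i - k - 1 : ℕ) + 1 : ℤ) := by omega
    rw [this, padeInterp_eval_neg (by omega), mul_zero]

lemma coeff_padeNumer_ne_zero (a b : ℕ) :
    ((1 - X) ^ (a + b + 1) * padeDenom a b).coeff b ≠ 0 := by
  have h := coeff_one_sub_X_pow_mul_padeDenom (show b ≤ a + b by omega)
  rw [Finset.sum_eq_single (a + b + 1)] at h
  · intro h0
    rw [h0, mul_zero, zero_eq_neg, Nat.choose_self] at h
    have : (b : ℤ) - (a + b + 1 : ℕ) = -(a + 1 : ℤ) := by push_cast; ring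
    rw [this] at h
    have h1 := padeInterp_eval_neg_ne_zero a b
    simp_all
  · intro i hi hne
    rw [Finset.mem_Ico] at hi
    have : (b : ℤ) - i = -((i - b - 1 : ℕ) + 1 : ℤ) := by omega
    rw [this, padeInterp_eval_neg (by omega), mul_zero]
  · simp

lemma padeDenom_coeff_abs_le (a b j : ℕ) : |(padeDenom a b).coeff j| ≤ 4 ^ (a + b) * 4 ^ (a + b) := by
  rw [padeDenom_coeff]
  split_ifs with h
  · rw [Nat.abs_cast]
    have h4 : ∀ n k, n ≤ 2 * (a + b) → n.choose k ≤ 4 ^ (a + b) := fun n k hn =>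
      (Nat.choose_le_two_pow n k).trans ((Nat.pow_le_pow_right (by norm_num) hn).trans
        (by rw [pow_mul]; norm_num))
    have := Nat.mul_le_mul (h4 (j + a) a (by omega)) (h4 (a - j + b) b (by omega))
    exact_mod_cast this
  · simp

lemma coeff_padeNumer_abs_le (a b k : ℕ) (hk : k ≤ 2 * (a + b) + 1) :
    |((1 - X) ^ (a + b + 1) * padeDenom a b).coeff k| ≤ 2 * 1024 ^ (a + b + 1) := by
  rw [coeff_mul, Finset.Nat.sum_antidiagonal_eq_sum_range_succ_mk]
  refine (Finset.abs_sum_le_sum_abs _ _).trans ?_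
  refine (Finset.sum_le_sum (g := fun _ => 2 ^ (a + b + 1) * (4 ^ (a + b) * 4 ^ (a + b)))
    fun i _ => ?_).trans ?_
  · rw [abs_mul, coeff_one_sub_X_pow, abs_mul, abs_pow, abs_neg, abs_one, one_pow, one_mul]
    refine mul_le_mul ?_ (padeDenom_coeff_abs_le _ _ _) (abs_nonneg _) (by positivity)
    rw [Nat.abs_cast]
    exact_mod_cast Nat.choose_le_two_pow _ _
  · rw [Finset.sum_const, Finset.card_range, nsmul_eq_mul]
    have h1 : (k + 1 : ℕ) ≤ 2 * 2 ^ (a + b + 1) := by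
      have : a + b + 1 < 2 ^ (a + b + 1) := Nat.lt_two_pow_self
      omega
    have h2 : (1024 : ℤ) ^ (a + b + 1) =
       2 ^ (a + b + 1) * 2 ^ (a + b + 1) * (16 ^ (a + b + 1)) * (16 ^ (a + b + 1)) := by
      rw [← mul_pow, ← mul_pow, ← mul_pow]; norm_num
    have h3 : (4 : ℤ) ^ (a + b) ≤ 16 ^ (a + b + 1) :=
      (pow_le_pow_left₀ (by norm_num) (by norm_num) _).trans
        (pow_le_pow_right₀ (by norm_num) (by omega))
    rw [h2]
    calc ((k + 1 : ℕ) : ℤ) * (2 ^ (a + b + 1) * (4 ^ (a + b) * 4 ^ (a + b)))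
        ≤ (2 * 2 ^ (a + b + 1)) * (2 ^ (a + b + 1) * (16 ^ (a + b + 1) * 16 ^ (a + b + 1))) := by
          gcongr
          exact_mod_cast h1
      _ = _ := by ring

/-- The Padé approximants `R / Q` of type `(b, a)` to `(1 - X) ^ (a + b + 1)`. -/
lemma exists_pade (a b N : ℕ) (ha : a ≤ N) (hb : b ≤ N) : ∃ P R : ℤ[X],
    X ^ (a + b + 1) * P + (1 - X) ^ (a + b + 1) * padeDenom a b = R ∧
    P.natDegree ≤ N ∧ R.natDegree ≤ b ∧ R.coeff b ≠ 0 ∧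
    (∀ i, |P.coeff i| ≤ 2 * 1024 ^ (2 * N + 1)) ∧ (∀ i, |R.coeff i| ≤ 2 * 1024 ^ (2 * N + 1)) := by
  set F : ℤ[X] := (1 - X) ^ (a + b + 1) * padeDenom a b with hF
  have hQ : (padeDenom a b).natDegree ≤ a := natDegree_le_iff_coeff_eq_zero.2 fun j hj => by
    rw [padeDenom_coeff, if_neg (by omega)]
  have hFd : F.natDegree ≤ 2 * a + b + 1 := by
    refine natDegree_mul_le.trans ?_
    have : ((1 - X : ℤ[X]) ^ (a + b + 1)).natDegree ≤ a + b + 1 := by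
      refine natDegree_pow_le.trans ?_
      have : (1 - X : ℤ[X]).natDegree ≤ 1 := (natDegree_sub_le _ _).trans (by simp)
      nlinarith
    omega
  have hFb : ∀ i, |F.coeff i| ≤ 2 * 1024 ^ (2 * N + 1) := fun i => by
    by_cases hi : i ≤ 2 * (a + b) + 1
    · refine (coeff_padeNumer_abs_le a b i hi).trans ?_
      gcongr
      · norm_num
      · omega
    · rw [coeff_eq_zero_of_natDegree_lt (by omega)]; simp
  have hP : ∀ j, (∑ i ∈ Finset.range (N + 1), C (-F.coeff (a + b + 1 + i)) * X ^ i).coeff j =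
      if j ≤ N then -F.coeff (a + b + 1 + j) else 0 := fun j => by
    simp only [finsetSum_coeff, coeff_C_mul_X_pow]
    simp
  have hR : ∀ j, (∑ i ∈ Finset.range (b + 1), C (F.coeff i) * X ^ i).coeff j =
      if j ≤ b then F.coeff j else 0 := fun j => by
    simp only [finsetSum_coeff, coeff_C_mul_X_pow]
    simp
  refine ⟨∑ i ∈ Finset.range (N + 1), C (-F.coeff (a + b + 1 + i)) * X ^ i,
    ∑ i ∈ Finset.range (b + 1), C (F.coeff i) * X ^ i, ?_, ?_, ?_, ?_, ?_, ?_⟩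
  · ext k
    rw [coeff_add, coeff_X_pow_mul', hP, hR]
    split_ifs with h1 h2 h3 h3
    · omega
    · rw [Nat.add_sub_cancel' h1]; ring
    · omega
    · rw [coeff_eq_zero_of_natDegree_lt (p := F) (by omega)]; ring
    · ring
    · rw [zero_add]; exact coeff_padeNumer_eq_zero (by omega) (by omega)
  · exact natDegree_le_iff_coeff_eq_zero.2 fun j hj => by rw [hP, if_neg (by omega)]
  · exact natDegree_le_iff_coeff_eq_zero.2 fun j hj => by rw [hR, if_neg (by omega)]
  · rw [hR, if_pos le_rfl]; exact coeff_padeNumer_ne_zero a b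
  · intro i
    rw [hP]
    split_ifs
    · rw [abs_neg]; exact hFb _
    · simp
  · intro i
    rw [hR]
    split_ifs
    · exact hFb _
    · simp

lemma AbsoluteValue.apply_int_le_abs {K : Type*} [Field K] (v : AbsoluteValue K ℝ) (n : ℤ) :
    v (n : K) ≤ |(n : ℝ)| := by
  have h := v.apply_nat_le_self n.natAbs
  rw [← Int.cast_natCast (R := ℝ), Int.natCast_natAbs, Int.cast_abs] at h
  refine le_trans (le_of_eq ?_) h
  rcases Int.natAbs_eq n with h | h
  · rw [h]; simp
  · rw [h]; simp

lemma AbsoluteValue.aeval_le {K : Type*} [Field K] (v : AbsoluteValue K ℝ) {F : ℤ[X]} {N : ℕ}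
    (hF : F.natDegree ≤ N) {B : ℝ} (hB : ∀ i, |(F.coeff i : ℝ)| ≤ B) (x : K) {M : ℝ}
    (hM : 1 ≤ M) (hx : v x ≤ M) : v (aeval x F) ≤ (N + 1) * B * M ^ N := by
  have hB0 : 0 ≤ B := (abs_nonneg _).trans (hB 0)
  rw [aeval_eq_sum_range' (Nat.lt_succ_of_le hF)]
  refine (v.sum_le _ _).trans ?_
  refine (Finset.sum_le_sum (g := fun _ => B * M ^ N) fun i hi => ?_).trans (by simp [mul_assoc])
  rw [Finset.mem_range] at hi
  rw [zsmul_eq_mul, v.map_mul, v.map_pow]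
  refine mul_le_mul ((v.apply_int_le_abs _).trans (hB i)) ?_ (by positivity) hB0
  exact (pow_le_pow_left₀ (v.nonneg _) hx _).trans (pow_le_pow_right₀ hM (by omega))

/-- Padé approximants to `(1 - X) ^ (2 * N)`, evaluated at a point. -/
structure IsPade {K : Type*} [Field K] (N : ℕ) (P Q R : ℤ[X]) (x : K) : Prop where
  eq : x ^ (2 * N) * aeval x P + (1 - x) ^ (2 * N) * aeval x Q = aeval x R
  degP : P.natDegree ≤ N
  degQ : Q.natDegree ≤ N
  degR : R.natDegree ≤ N
  coeffP : ∀ i, |P.coeff i| ≤ 2 * 1024 ^ (2 * N + 1)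
  coeffQ : ∀ i, |Q.coeff i| ≤ 2 * 1024 ^ (2 * N + 1)
  coeffR : ∀ i, |R.coeff i| ≤ 2 * 1024 ^ (2 * N + 1)

lemma padeDenom_natDegree (a b : ℕ) : (padeDenom a b).natDegree ≤ a :=
  natDegree_le_iff_coeff_eq_zero.2 fun j hj => by rw [padeDenom_coeff, if_neg (by omega)]

lemma padeDenom_coeff_le (a b N : ℕ) (h : a + b ≤ 2 * N) (i : ℕ) :
    |(padeDenom a b).coeff i| ≤ 2 * 1024 ^ (2 * N + 1) := by
  refine (padeDenom_coeff_abs_le a b i).trans ?_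
  rw [← mul_pow]
  calc (4 * 4 : ℤ) ^ (a + b) ≤ 1024 ^ (a + b) := pow_le_pow_left₀ (by norm_num) (by norm_num) _
    _ ≤ 1024 ^ (2 * N + 1) := pow_le_pow_right₀ (by norm_num) (by omega)
    _ ≤ _ := by linarith [pow_pos (show (0 : ℤ) < 1024 by norm_num) (2 * N + 1)]

lemma exists_isPade_pair (K : Type*) [Field K] [CharZero K] (N : ℕ) (hN : 1 ≤ N) :
    ∃ P Q R P' Q' R' : ℤ[X], ∀ x : K, x ≠ 0 → IsPade N P Q R x ∧ IsPade N P' Q' R' x ∧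
      aeval x R * aeval x Q' - aeval x R' * aeval x Q ≠ 0 := by
  obtain ⟨M, rfl⟩ := Nat.exists_eq_add_of_le' hN
  obtain ⟨P, R, h, hP, hR, hR0, hPc, hRc⟩ := exists_pade M (M + 1) (M + 1) (by omega) le_rfl
  obtain ⟨P', R', h', hP', hR', hR0', hPc', hRc'⟩ :=
    exists_pade (M + 1) M (M + 1) le_rfl (by omega)
  have e1 : M + (M + 1) + 1 = 2 * (M + 1) := by ring
  have e2 : M + 1 + M + 1 = 2 * (M + 1) := by ring
  rw [e1] at h
  rw [e2] at h'
  set Q := padeDenom M (M + 1) with hQdef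
  set Q' := padeDenom (M + 1) M with hQdef'
  have hQ : Q.natDegree ≤ M := padeDenom_natDegree _ _
  have hQ' : Q'.natDegree ≤ M + 1 := padeDenom_natDegree _ _
  have hfac : R * Q' - R' * Q = X ^ (2 * (M + 1)) * (P * Q' - P' * Q) := by
    rw [← h, ← h']; ring
  have hdeg : (R' * Q).natDegree < 2 * (M + 1) := by
    have := natDegree_mul_le (p := R') (q := Q)
    omega
  have hc : (R * Q' - R' * Q).coeff (2 * (M + 1)) ≠ 0 := by
    rw [coeff_sub, coeff_eq_zero_of_natDegree_lt hdeg, sub_zero, two_mul,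
      coeff_mul_add_eq_of_natDegree_le hR hQ']
    refine mul_ne_zero hR0 ?_
    rw [hQdef', padeDenom_coeff, if_pos le_rfl]
    have := Nat.choose_pos (show M + 1 ≤ M + 1 + (M + 1) by omega)
    simp; omega
  set c := (R * Q' - R' * Q).coeff (2 * (M + 1)) with hcdef
  have hG : R * Q' - R' * Q = C c * X ^ (2 * (M + 1)) := by
    ext i
    rw [coeff_C_mul_X_pow]
    split_ifs with hi
    · rw [hi]
    · rcases lt_or_gt_of_ne hi with hi | hi
      · rw [hfac, coeff_X_pow_mul', if_neg (by omega)]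
      · refine coeff_eq_zero_of_natDegree_lt (lt_of_le_of_lt (natDegree_sub_le _ _) ?_)
        have := natDegree_mul_le (p := R) (q := Q')
        omega
  refine ⟨P, Q, R, P', Q', R', fun x hx => ⟨⟨?_, hP, by omega, hR, hPc, ?_, hRc⟩,
    ⟨?_, hP', hQ', by omega, hPc', ?_, hRc'⟩, ?_⟩⟩
  · simpa using congrArg (aeval x) h
  · exact padeDenom_coeff_le _ _ _ (by omega)
  · simpa using congrArg (aeval x) h'
  · exact padeDenom_coeff_le _ _ _ (by omega)
  · have := congrArg (aeval x) hG
    simp only [map_sub, map_mul, map_pow, aeval_X] at this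
    rw [this, aeval_C]
    refine mul_ne_zero ?_ (pow_ne_zero _ hx)
    simpa using hc

/-- The local factor of the height of `(1 : x : y)`. -/
noncomputable def localHeight {K : Type*} [Field K] (v : AbsoluteValue K ℝ) (x y : K) : ℝ :=
  max 1 (max (v x) (v y))

lemma one_le_localHeight {K : Type*} [Field K] (v : AbsoluteValue K ℝ) (x y : K) :
    1 ≤ localHeight v x y := le_max_left _ _

lemma IsPade.abv_le {K : Type*} [Field K] {N : ℕ} (hN : 1 ≤ N) (v : AbsoluteValue K ℝ)
    {F : ℤ[X]} {x : K} (hF : F.natDegree ≤ N) (hc : ∀ i, |F.coeff i| ≤ 2 * 1024 ^ (2 * N + 1)) :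
    2 * v (aeval x F) ≤ (2 ^ 33) ^ N * localHeight v x (1 - x) ^ N := by
  have h1 := v.aeval_le hF (B := 2 * 1024 ^ (2 * N + 1))
    (fun i => by exact_mod_cast hc i) x (one_le_localHeight v x (1 - x))
    ((le_max_left _ _).trans (le_max_right _ _))
  have h2 : (N + 1 : ℝ) ≤ 2 ^ N := by exact_mod_cast (Nat.lt_two_pow_self (n := N))
  have h3 : (2 : ℝ) ≤ 2 ^ N := by simpa using pow_le_pow_right₀ (show (1 : ℝ) ≤ 2 by norm_num) hN
  have h4 : (1024 : ℝ) ^ (2 * N + 1) ≤ (2 ^ 30) ^ N := by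
    rw [show (2 : ℝ) ^ 30 = 1024 ^ 3 by norm_num, ← pow_mul]
    exact pow_le_pow_right₀ (by norm_num) (by omega)
  have h0 := one_le_localHeight v x (1 - x)
  calc 2 * v (aeval x F) ≤ 2 * ((N + 1) * (2 * 1024 ^ (2 * N + 1)) * localHeight v x (1 - x) ^ N) := by
        gcongr
    _ ≤ 2 ^ N * (2 ^ N * (2 ^ N * (2 ^ 30) ^ N) * localHeight v x (1 - x) ^ N) := by
        gcongr
    _ = _ := by
        rw [show (2 : ℝ) ^ 33 = 2 * 2 * 2 * 2 ^ 30 by norm_num]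
        rw [mul_pow (2 * 2 * 2 : ℝ), mul_pow (2 * 2 : ℝ), mul_pow (2 : ℝ)]; ring

lemma localHeight_pow_le {K : Type*} [Field K] {N : ℕ} (hN : 1 ≤ N) (v : AbsoluteValue K ℝ)
    {P Q R : ℤ[X]} {x a b : K} (h : IsPade N P Q R x)
    (hab : a * x ^ (2 * N) + b * (1 - x) ^ (2 * N) = 1) :
    v (a * aeval x Q - b * aeval x P) * localHeight v x (1 - x) ^ (2 * N) ≤
      (2 ^ 33) ^ N * localHeight v x (1 - x) ^ N * localHeight v a b := by
  set p := aeval x P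
  set q := aeval x Q
  set r := aeval x R
  set W := (2 ^ 33) ^ N * localHeight v x (1 - x) ^ N
  set H := localHeight v a b with hH
  have hW : 0 ≤ W := mul_nonneg (by positivity) (pow_nonneg (zero_le_one.trans (one_le_localHeight ..)) _)
  have hp : 2 * v p ≤ W := IsPade.abv_le hN v h.degP h.coeffP
  have hq : 2 * v q ≤ W := IsPade.abv_le hN v h.degQ h.coeffQ
  have hr : 2 * v r ≤ W := IsPade.abv_le hN v h.degR h.coeffR
  have heq : x ^ (2 * N) * p + (1 - x) ^ (2 * N) * q = r := h.eq
  have H1 : 1 ≤ H := one_le_localHeight ..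
  have Ha : v a ≤ H := (le_max_left _ _).trans (le_max_right _ _)
  have Hb : v b ≤ H := (le_max_right _ _).trans (le_max_right _ _)
  have key : ∀ s t u w : K, v s ≤ H → v u ≤ H → 2 * v t ≤ W → 2 * v w ≤ W →
      v (s * t - u * w) ≤ W * H := fun s t u w hs hu ht hw => by
    refine (v.sub_le_add _ _).trans ?_
    rw [v.map_mul, v.map_mul]
    have h1 : v s * v t ≤ H * (W / 2) :=
      mul_le_mul hs (by linarith) (v.nonneg _) (by linarith)
    have h2 : v u * v w ≤ H * (W / 2) :=
      mul_le_mul hu (by linarith) (v.nonneg _) (by linarith)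
    linarith
  have e1 : (a * q - b * p) * x ^ (2 * N) = 1 * q - b * r := by
    rw [← heq]; linear_combination q * hab
  have e2 : (a * q - b * p) * (1 - x) ^ (2 * N) = a * r - 1 * p := by
    rw [← heq]; linear_combination -p * hab
  have v1 : v 1 ≤ H := by rw [v.map_one]; exact H1
  have k0 := key a q b p Ha Hb hq hp
  have k1 := key 1 q b r v1 Hb hq hr
  have k2 := key a r 1 p Ha v1 hr hp
  rw [← e1, v.map_mul, v.map_pow] at k1
  rw [← e2, v.map_mul, v.map_pow] at k2
  unfold localHeight
  rcases max_choice 1 (max (v x) (v (1 - x))) with h | h <;> rw [h]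
  · simpa using k0
  · rcases max_choice (v x) (v (1 - x)) with h | h <;> rw [h]
    · exact k1
    · exact k2

/-- The gap principle, in multiplicative form. -/
lemma prod_localHeight_pow_le {K : Type*} [Field K] [CharZero K] {ι : Type*} [Fintype ι]
    (v : ι → AbsoluteValue K ℝ) (O : Subring K)
    (hO : ∀ d ∈ O, d ≠ 0 → 1 ≤ ∏ i, v i d) {N : ℕ} (hN : 1 ≤ N) {x a b : K} (hx : x ∈ O)
    (hx0 : x ≠ 0) (ha : a ∈ O) (hb : b ∈ O)
    (hab : a * x ^ (2 * N) + b * (1 - x) ^ (2 * N) = 1) :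
    ∏ i, localHeight (v i) x (1 - x) ^ (2 * N) ≤
      ∏ i, ((2 ^ 33) ^ N * localHeight (v i) x (1 - x) ^ N * localHeight (v i) a b) := by
  have hmem : ∀ F : ℤ[X], aeval x F ∈ O := fun F => by
    rw [aeval_eq_sum_range]
    exact O.sum_mem fun i _ => O.zsmul_mem (O.pow_mem hx _) _
  have hpos : ∀ i, 0 ≤ localHeight (v i) x (1 - x) := fun i =>
    zero_le_one.trans (one_le_localHeight ..)
  have main : ∀ P Q R : ℤ[X], IsPade N P Q R x → a * aeval x Q - b * aeval x P ≠ 0 →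
      ∏ i, localHeight (v i) x (1 - x) ^ (2 * N) ≤
      ∏ i, ((2 ^ 33) ^ N * localHeight (v i) x (1 - x) ^ N * localHeight (v i) a b) := by
    intro P Q R h hd
    have h1 := hO _ (O.sub_mem (O.mul_mem ha (hmem Q)) (O.mul_mem hb (hmem P))) hd
    calc _ ≤ (∏ i, v i (a * aeval x Q - b * aeval x P)) *
          ∏ i, localHeight (v i) x (1 - x) ^ (2 * N) :=
          le_mul_of_one_le_left (Finset.prod_nonneg fun i _ => pow_nonneg (hpos i) _) h1
      _ = ∏ i, (v i (a * aeval x Q - b * aeval x P) * localHeight (v i) x (1 - x) ^ (2 * N)) :=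
          Finset.prod_mul_distrib.symm
      _ ≤ _ := Finset.prod_le_prod
          (fun i _ => mul_nonneg ((v i).nonneg _) (pow_nonneg (hpos i) _))
          (fun i _ => localHeight_pow_le hN (v i) h hab)
  obtain ⟨P, Q, R, P', Q', R', h⟩ := exists_isPade_pair K N hN
  obtain ⟨h1, h2, hne⟩ := h x hx0
  by_cases hd : a * aeval x Q - b * aeval x P = 0
  · refine main P' Q' R' h2 fun hd' => hne ?_
    have e1 : aeval x Q = b * aeval x R := by
      rw [← h1.eq]; linear_combination -aeval x Q * hab + x ^ (2 * N) * hd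
    have e2 : aeval x Q' = b * aeval x R' := by
      rw [← h2.eq]; linear_combination -aeval x Q' * hab + x ^ (2 * N) * hd'
    rw [e1, e2]; ring
  · exact main P Q R h1 hd

end Pade

/-- The logarithmic height as a function of the logarithms of the absolute values. -/
noncomputable def logHt {ι : Type*} [Fintype ι] (e : ι → ℝ × ℝ) : ℝ :=
  ∑ i, max 0 (max (e i).1 (e i).2)

section logHt

variable {ι : Type*} [Fintype ι]

lemma logHt_add_le (e f : ι → ℝ × ℝ) : logHt (e + f) ≤ logHt e + logHt f := by
  rw [logHt, logHt, logHt, ← Finset.sum_add_distrib]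
  refine Finset.sum_le_sum fun i _ => ?_
  simp only [Pi.add_apply, Prod.fst_add, Prod.snd_add]
  have := le_max_left 0 (max (e i).1 (e i).2)
  have := le_max_left 0 (max (f i).1 (f i).2)
  have := (le_max_left (e i).1 (e i).2).trans (le_max_right 0 _)
  have := (le_max_left (f i).1 (f i).2).trans (le_max_right 0 _)
  have := (le_max_right (e i).1 (e i).2).trans (le_max_right 0 _)
  have := (le_max_right (f i).1 (f i).2).trans (le_max_right 0 _)
  refine max_le (by linarith) (max_le (by linarith) (by linarith))

lemma logHt_smul {c : ℝ} (hc : 0 ≤ c) (e : ι → ℝ × ℝ) : logHt (c • e) = c * logHt e := by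
  rw [logHt, logHt, Finset.mul_sum]
  refine Finset.sum_congr rfl fun i _ => ?_
  simp [mul_max_of_nonneg _ _ hc]

lemma logHt_le_norm (e : ι → ℝ × ℝ) : logHt e ≤ Fintype.card ι * ‖e‖ := by
  refine (Finset.sum_le_sum (g := fun _ => ‖e‖) fun i _ => ?_).trans (by simp)
  have h1 : ‖e i‖ ≤ ‖e‖ := norm_le_pi_norm e i
  have h2 := norm_fst_le (e i)
  have h3 := norm_snd_le (e i)
  have h4 := le_abs_self (e i).1
  have h5 := le_abs_self (e i).2
  rw [← Real.norm_eq_abs] at h4 h5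
  exact max_le (norm_nonneg _) (max_le (by linarith) (by linarith))

lemma le_logHt (e : ι → ℝ × ℝ) (s : Finset ι) :
    ∑ i ∈ s, (e i).1 ≤ logHt e ∧ ∑ i ∈ s, (e i).2 ≤ logHt e := by
  have h : ∑ i ∈ s, max 0 (max (e i).1 (e i).2) ≤ logHt e :=
    Finset.sum_le_sum_of_subset_of_nonneg (Finset.subset_univ s) fun i _ _ => le_max_left _ _
  exact ⟨(Finset.sum_le_sum fun i _ => (le_max_left _ _).trans (le_max_right _ _)).trans h,
    (Finset.sum_le_sum fun i _ => (le_max_right _ _).trans (le_max_right _ _)).trans h⟩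

lemma norm_le_logHt (e : ι → ℝ × ℝ) (h1 : ∑ i, (e i).1 = 0) (h2 : ∑ i, (e i).2 = 0) :
    ‖e‖ ≤ logHt e := by
  classical
  have h0 : 0 ≤ logHt e := Finset.sum_nonneg fun i _ => le_max_left _ _
  refine (pi_norm_le_iff_of_nonneg h0).2 fun i => ?_
  have ha := le_logHt e {i}
  have hb := le_logHt e (Finset.univ.erase i)
  have s1 := Finset.add_sum_erase Finset.univ (fun i => (e i).1) (Finset.mem_univ i)
  have s2 := Finset.add_sum_erase Finset.univ (fun i => (e i).2) (Finset.mem_univ i)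
  simp only [Finset.sum_singleton] at ha s1 s2
  refine norm_prod_le_iff.2 ⟨abs_le.2 ⟨?_, ha.1⟩, abs_le.2 ⟨?_, ha.2⟩⟩ <;> linarith [hb.1, hb.2]

end logHt

/-- Two vectors of nearly the same direction, one much longer than the other, violate the gap
principle. -/
lemma logHt_gap_contradiction {ι : Type*} [Fintype ι] {e e' : ι → ℝ × ℝ} {c : ℝ} (hc : 0 ≤ c)
    (he : 4 * c < logHt e) (hee' : 20 * logHt e ≤ logHt e')
    (hdir : ‖(logHt e')⁻¹ • e' - (logHt e)⁻¹ • e‖ ≤ (4 * (Fintype.card ι + 1) : ℝ)⁻¹)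
    (hgap : ∀ N : ℕ, 1 ≤ N → N * logHt e ≤ logHt (e' - (2 * N : ℝ) • e) + N * c) : False := by
  set h := logHt e with hh
  set h' := logHt e' with hh'
  have hpos : 0 < h := by linarith
  have hpos' : 0 < h' := by linarith
  set u := h⁻¹ • e with hu
  set u' := h'⁻¹ • e' with hu'
  have eu : e = h • u := by rw [hu, smul_inv_smul₀ hpos.ne']
  have eu' : e' = h' • u' := by rw [hu', smul_inv_smul₀ hpos'.ne']
  have hu1 : logHt u = 1 := by
    rw [hu, logHt_smul (by positivity), ← hh, inv_mul_cancel₀ hpos.ne']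
  set N := ⌊h' / h / 2⌋₊ with hN
  have hl : (20 : ℝ) ≤ h' / h := by rw [le_div_iff₀ hpos]; exact hee'
  have hN1 : (N : ℝ) ≤ h' / h / 2 := Nat.floor_le (by positivity)
  have hN2 : h' / h / 2 < N + 1 := Nat.lt_floor_add_one _
  have hN10 : 10 ≤ N := Nat.le_floor (by push_cast; linarith)
  have hN10' : (10 : ℝ) ≤ N := by exact_mod_cast hN10
  have hg := hgap N (by omega)
  have hA : (2 * N : ℝ) * h ≤ h' := by
    rw [← le_div_iff₀ hpos]; linarith
  have hB : h' ≤ (2 * N + 2) * h := by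
    rw [← div_le_iff₀ hpos]; linarith
  have dec : e' - (2 * N : ℝ) • e = h' • (u' - u) + (h' - 2 * N * h) • u := by
    rw [smul_sub, sub_smul, ← eu', mul_smul (2 * N : ℝ) h u, ← eu]; abel
  have hbound : logHt (e' - (2 * N : ℝ) • e) ≤ h' * (1 / 4) + (h' - 2 * N * h) := by
    rw [dec]
    refine (logHt_add_le _ _).trans ?_
    rw [logHt_smul hpos'.le, logHt_smul (by linarith), hu1, mul_one]
    have : logHt (u' - u) ≤ 1 / 4 := by
      refine (logHt_le_norm _).trans ?_
      calc (Fintype.card ι : ℝ) * ‖u' - u‖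
          ≤ (Fintype.card ι + 1 : ℝ) * (4 * (Fintype.card ι + 1) : ℝ)⁻¹ := by
            gcongr
            linarith
        _ = 1 / 4 := by field_simp
    gcongr
  have hNc : N * c ≤ N * (h / 4) := by gcongr; linarith
  have : 10 * h ≤ N * h := by gcongr
  nlinarith

open Real in
/-- Finiteness of the number of solutions of the unit equation `x + y = 1` in a subring whose
elements satisfy the product inequality and Northcott's property. -/
theorem finite_unit_equation {K : Type*} [Field K] [CharZero K] {ι : Type*} [Fintype ι]
    (v : ι → AbsoluteValue K ℝ) (O : Subring K)
    (hO : ∀ d ∈ O, d ≠ 0 → 1 ≤ ∏ i, v i d)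
    (hfin : ∀ B : ℝ, {x | x ∈ O ∧ ∀ i, v i x ≤ B}.Finite) :
    {x : K | (x ≠ 0 ∧ x ∈ O ∧ x⁻¹ ∈ O) ∧ (1 - x ≠ 0 ∧ 1 - x ∈ O ∧ (1 - x)⁻¹ ∈ O)}.Finite := by
  set T := {x : K | (x ≠ 0 ∧ x ∈ O ∧ x⁻¹ ∈ O) ∧ (1 - x ≠ 0 ∧ 1 - x ∈ O ∧ (1 - x)⁻¹ ∈ O)} with hT
  by_contra hinf
  let ell : K → K → ι → ℝ × ℝ := fun x y i => (log (v i x), log (v i y))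
  have hell : ∀ x y i, x ≠ 0 → y ≠ 0 →
      log (localHeight (v i) x y) = max 0 (max (ell x y i).1 (ell x y i).2) := by
    intro x y i hx hy
    have px := (v i).pos hx
    have py := (v i).pos hy
    have hm : ∀ s t : ℝ, 0 < s → 0 < t → log (max s t) = max (log s) (log t) := fun s t hs ht => by
      rcases le_total s t with h | h
      · rw [max_eq_right h, max_eq_right (log_le_log hs h)]
      · rw [max_eq_left h, max_eq_left (log_le_log ht h)]
    rw [localHeight, hm _ _ one_pos (lt_max_of_lt_left px), hm _ _ px py, log_one]
  have hsum : ∀ x, x ≠ 0 → x ∈ O → x⁻¹ ∈ O → ∑ i, log (v i x) = 0 := by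
    intro x hx h1 h2
    rw [← log_prod fun i _ => (v i).ne_zero hx]
    have a1 := hO x h1 hx
    have a2 := hO _ h2 (inv_ne_zero hx)
    simp only [map_inv₀, Finset.prod_inv_distrib] at a2
    have a3 : ∏ i, v i x ≤ 1 := by
      by_contra hlt
      exact absurd a2 (not_le.2 (inv_lt_one_of_one_lt₀ (not_le.1 hlt)))
    rw [le_antisymm a3 a1, log_one]
  let ht : K → ℝ := fun x => logHt (ell x (1 - x))
  have north : ∀ B : ℝ, {x | x ∈ T ∧ ht x ≤ B}.Finite := by
    intro B
    refine (hfin (exp B)).subset fun x hx => ⟨hx.1.1.2.1, fun i => ?_⟩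
    rw [← log_le_iff_le_exp ((v i).pos hx.1.1.1)]
    have := (le_logHt (ell x (1 - x)) {i}).1
    rw [Finset.sum_singleton] at this
    exact this.trans hx.2
  set c : ℝ := Fintype.card ι * log (2 ^ 33) with hc
  have hc0 : 0 ≤ c := mul_nonneg (by positivity) (log_nonneg (by norm_num))
  have gap : ∀ x ∈ T, ∀ x' ∈ T, ∀ N : ℕ, 1 ≤ N → N * logHt (ell x (1 - x)) ≤
      logHt (ell x' (1 - x') - (2 * N : ℝ) • ell x (1 - x)) + N * c := by
    intro x hx x' hx' N hN
    obtain ⟨⟨x0, xO, xI⟩, y0, yO, yI⟩ := hx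
    obtain ⟨⟨x0', xO', xI'⟩, y0', yO', yI'⟩ := hx'
    have a0 : x' * x⁻¹ ^ (2 * N) ≠ 0 := mul_ne_zero x0' (pow_ne_zero _ (inv_ne_zero x0))
    have b0 : (1 - x') * (1 - x)⁻¹ ^ (2 * N) ≠ 0 :=
      mul_ne_zero y0' (pow_ne_zero _ (inv_ne_zero y0))
    have key := prod_localHeight_pow_le v O hO hN xO x0
      (O.mul_mem xO' (O.pow_mem xI (2 * N))) (O.mul_mem yO' (O.pow_mem yI (2 * N)))
      (by rw [mul_assoc, ← mul_pow, inv_mul_cancel₀ x0, mul_assoc, ← mul_pow,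
        inv_mul_cancel₀ y0]; ring)
    have hp : ∀ i s t, 0 < localHeight (v i) s t := fun i s t =>
      zero_lt_one.trans_le (one_le_localHeight ..)
    have key2 := log_le_log (Finset.prod_pos fun i _ => pow_pos (hp i _ _) _) key
    have hell' : ell (x' * x⁻¹ ^ (2 * N)) ((1 - x') * (1 - x)⁻¹ ^ (2 * N)) =
        ell x' (1 - x') - (2 * N : ℝ) • ell x (1 - x) := by
      funext i
      have l1 : ∀ s t : K, s ≠ 0 → t ≠ 0 →
          log (v i (s * t⁻¹ ^ (2 * N))) = log (v i s) - 2 * N * log (v i t) := by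
        intro s t hs ht
        rw [(v i).map_mul, (v i).map_pow, map_inv₀, log_mul ((v i).ne_zero hs)
          (pow_ne_zero _ (inv_ne_zero ((v i).ne_zero ht))), log_pow, log_inv]
        push_cast; ring
      simp only [ell, l1 _ _ x0' x0, l1 _ _ y0' y0]
      rfl
    rw [log_prod fun i _ => (pow_pos (hp i _ _) _).ne', log_prod fun i _ =>
      (mul_pos (mul_pos (by positivity) (pow_pos (hp i _ _) _)) (hp i _ _)).ne'] at key2
    have e1 : ∑ i, log (localHeight (v i) x (1 - x) ^ (2 * N)) =
        2 * N * logHt (ell x (1 - x)) := by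
      rw [logHt, Finset.mul_sum]
      refine Finset.sum_congr rfl fun i _ => ?_
      rw [log_pow, hell _ _ _ x0 y0]; push_cast; ring
    have e2 : ∑ i, log ((2 ^ 33) ^ N * localHeight (v i) x (1 - x) ^ N *
        localHeight (v i) (x' * x⁻¹ ^ (2 * N)) ((1 - x') * (1 - x)⁻¹ ^ (2 * N))) =
        N * c + N * logHt (ell x (1 - x)) +
          logHt (ell x' (1 - x') - (2 * N : ℝ) • ell x (1 - x)) := by
      rw [← hell', logHt, logHt, Finset.mul_sum]
      have : (N : ℝ) * c = ∑ _i : ι, N * log (2 ^ 33) := by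
        rw [Finset.sum_const, Finset.card_univ, nsmul_eq_mul, hc]; ring
      rw [this, ← Finset.sum_add_distrib, ← Finset.sum_add_distrib]
      refine Finset.sum_congr rfl fun i _ => ?_
      rw [log_mul (mul_pos (by positivity) (pow_pos (hp i _ _) _)).ne' (hp i _ _).ne',
        log_mul (by positivity) (pow_pos (hp i _ _) _).ne', hell _ _ _ a0 b0,
        log_pow (2 ^ 33 : ℝ) N, log_pow (localHeight _ _ _) N,
        hell _ _ _ x0 y0]
    rw [e1, e2] at key2
    linarith
  have hT0 : {x | x ∈ T ∧ 4 * c < ht x}.Infinite := by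
    intro hf
    refine hinf ((hf.union (north (4 * c))).subset fun x hx => ?_)
    rcases lt_or_ge (4 * c) (ht x) with h | h
    · exact Or.inl ⟨hx, h⟩
    · exact Or.inr ⟨hx, h⟩
  let u : K → ι → ℝ × ℝ := fun x => (ht x)⁻¹ • ell x (1 - x)
  have hu : ∀ x ∈ T, 4 * c < ht x → u x ∈ Metric.closedBall (0 : ι → ℝ × ℝ) 1 := by
    rintro x ⟨⟨x0, xO, xI⟩, y0, yO, yI⟩ hx
    have hx0 : 0 < ht x := by linarith
    rw [mem_closedBall_zero_iff, norm_smul, norm_inv, Real.norm_of_nonneg hx0.le,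
      inv_mul_le_iff₀ hx0, mul_one]
    exact norm_le_logHt _ (hsum x x0 xO xI) (hsum _ y0 yO yI)
  set ε : ℝ := (4 * (Fintype.card ι + 1) : ℝ)⁻¹ with hε
  have hε0 : 0 < ε := by positivity
  obtain ⟨t, htf, hcov⟩ := Metric.totallyBounded_iff.1
    (isCompact_closedBall (0 : ι → ℝ × ℝ) 1).totallyBounded (ε / 2) (by positivity)
  obtain ⟨y, -, hy⟩ : ∃ y ∈ t, {x | (x ∈ T ∧ 4 * c < ht x) ∧ u x ∈ Metric.ball y (ε / 2)}.Infinite := by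
    by_contra! hcon
    refine hT0 ((htf.biUnion fun y hy => hcon y hy).subset fun x hx => ?_)
    obtain ⟨y, hy, hxy⟩ := Set.mem_iUnion₂.1 (hcov (hu x hx.1 hx.2))
    exact Set.mem_iUnion₂.2 ⟨y, hy, hx, hxy⟩
  obtain ⟨x, ⟨hxT, hxc⟩, hxy⟩ := hy.nonempty
  obtain ⟨x', ⟨⟨hxT', hxc'⟩, hxy'⟩, hbig⟩ : ∃ x' ∈ {x | (x ∈ T ∧ 4 * c < ht x) ∧
      u x ∈ Metric.ball y (ε / 2)}, 20 * ht x ≤ ht x' := by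
    by_contra! hcon
    exact hy ((north (20 * ht x)).subset fun x' hx' => ⟨hx'.1.1, (hcon x' hx').le⟩)
  refine logHt_gap_contradiction hc0 hxc hbig ?_ (gap x hxT x' hxT')
  rw [← dist_eq_norm]
  refine (dist_triangle_right (u x') (u x) y).trans ?_
  have h1 := Metric.mem_ball.1 hxy
  have h2 := Metric.mem_ball.1 hxy'
  linarith

section SInteger

open NumberField.HeightOneSpectrum NumberField.FinitePlace

theorem adicAbv_le_one_iff (v : HeightOneSpectrum (𝓞 K)) (x : K) :
    adicAbv K v x ≤ 1 ↔ v.valuation K x ≤ 1 := by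
  have h := (WithZeroMulInt.toNNReal_strictMono (one_lt_absNorm_nnreal v)).le_iff_le
    (a := v.valuation K x) (b := 1)
  rw [map_one] at h
  rw [adicAbv_def, ← h]
  norm_cast

/-- The product formula for the absolute values of `K` attached to the complex embeddings and to
the maximal ideals in `S`, evaluated at an `S`-integer. -/
theorem one_le_prod_place_mul_prod_adicAbv (S : Finset (HeightOneSpectrum (𝓞 K))) {d : K}
    (hd : ∀ v ∉ S, v.valuation K d ≤ 1) (hd0 : d ≠ 0) :
    1 ≤ (∏ φ : K →+* ℂ, NumberField.place φ d) * ∏ v : S, adicAbv K v.1 d := by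
  have h1 : ∏ φ : K →+* ℂ, NumberField.place φ d = |(Algebra.norm ℚ d : ℝ)| := by
    have := congr_arg (‖·‖) (Algebra.norm_eq_prod_embeddings ℚ ℂ d)
    rw [← Fintype.prod_equiv (RingHom.equivRatAlgHom K ℂ) (fun f => f d)
      (fun φ => φ d) fun _ => by simp [RingHom.equivRatAlgHom_apply]] at this
    simp only [norm_prod, eq_ratCast, Complex.norm_ratCast] at this
    exact this.symm
  have h2 := FinitePlace.prod_eq_inv_abs_norm hd0
  have hn : 0 < |(Algebra.norm ℚ d : ℝ)| := by
    rw [abs_pos]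
    exact_mod_cast Algebra.norm_ne_zero_iff.2 hd0
  rw [← finprod_comp_equiv equivHeightOneSpectrum.symm] at h2
  simp only [equivHeightOneSpectrum_symm_apply, norm_embedding] at h2
  have hf : (fun v : HeightOneSpectrum (𝓞 K) => adicAbv K v d).mulSupport.Finite := by
    refine Set.Finite.of_finite_image (f := equivHeightOneSpectrum.symm)
      ((hasFiniteMulSupport hd0).subset ?_) equivHeightOneSpectrum.symm.injective.injOn
    rintro _ ⟨v, hv, rfl⟩
    simpa [equivHeightOneSpectrum_symm_apply, norm_embedding] using hv
  rw [finprod_eq_prod_of_mulSupport_subset (s := hf.toFinset ∪ S) _ (fun v hv => by simp_all),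
    ← Finset.prod_sdiff (Finset.subset_union_right (s₁ := hf.toFinset))] at h2
  have h3 : ∏ v ∈ (hf.toFinset ∪ S) \ S, adicAbv K v d ≤ 1 :=
    Finset.prod_le_one (fun v _ => (adicAbv K v).nonneg d)
      fun v hv => (adicAbv_le_one_iff v d).2 (hd v (Finset.mem_sdiff.1 hv).2)
  have h4 := mul_le_of_le_one_left
    (Finset.prod_nonneg fun v (_ : v ∈ S) => (adicAbv K v).nonneg d) h3
  rw [h2] at h4
  rw [h1, Finset.prod_coe_sort S fun v => adicAbv K v d]
  push_cast at h4
  calc (1 : ℝ) = |(Algebra.norm ℚ d : ℝ)| * |(Algebra.norm ℚ d : ℝ)|⁻¹ :=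
        (mul_inv_cancel₀ hn.ne').symm
    _ ≤ _ := mul_le_mul_of_nonneg_left h4 hn.le

/-- Northcott's property for `S`-integers. -/
theorem finite_sInteger_of_abs_le (S : Finset (HeightOneSpectrum (𝓞 K))) (B : ℝ) :
    {x : K | (∀ v ∉ S, v.valuation K x ≤ 1) ∧ (∀ φ : K →+* ℂ, ‖φ x‖ ≤ B) ∧
      ∀ v ∈ S, adicAbv K v x ≤ B}.Finite := by
  have hD : ∃ D : 𝓞 K, D ≠ 0 ∧ ∀ v ∈ S, D ∈ v.asIdeal := by
    have : (∏ v ∈ S, v.asIdeal) ≠ ⊥ := Finset.prod_ne_zero_iff.2 fun v _ => v.ne_bot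
    obtain ⟨D, hD, hD0⟩ := Submodule.exists_mem_ne_zero_of_ne_bot this
    exact ⟨D, hD0, fun v hv => Ideal.le_of_dvd (Finset.dvd_prod_of_mem _ hv) hD⟩
  obtain ⟨D, hD0, hD⟩ := hD
  have hk : ∃ k : ℕ, ∀ v ∈ S, adicAbv K v (D : K) ^ k * B ≤ 1 := by
    have : ∀ᶠ k : ℕ in Filter.atTop, ∀ v ∈ S, adicAbv K v (D : K) ^ k * B ≤ 1 := by
      rw [Filter.eventually_all_finset]
      intro v hv
      have hlt : adicAbv K v (D : K) < 1 := by
        rw [← norm_embedding]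
        exact (norm_lt_one_iff_mem K v D).2 (hD v hv)
      have := (tendsto_pow_atTop_nhds_zero_of_lt_one ((adicAbv K v).nonneg _) hlt).mul_const B
      rw [zero_mul] at this
      exact (this.eventually (gt_mem_nhds one_pos)).mono fun k hk => hk.le
    exact this.exists
  obtain ⟨k, hk⟩ := hk
  have hDK : (D : K) ^ k ≠ 0 := pow_ne_zero _ (by simpa using hD0)
  obtain ⟨C, hC⟩ : ∃ C : ℝ, ∀ φ : K →+* ℂ, ‖φ ((D : K) ^ k)‖ ≤ C := by
    obtain ⟨C, hC⟩ := (Set.finite_range fun φ : K →+* ℂ => ‖φ ((D : K) ^ k)‖).bddAbove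
    exact ⟨C, fun φ => hC ⟨φ, rfl⟩⟩
  refine ((Embeddings.finite_of_norm_le K ℂ (C * B)).preimage
    ((mul_right_injective₀ hDK).injOn)).subset ?_
  rintro x ⟨h1, h2, h3⟩
  refine ⟨?_, fun φ => ?_⟩
  · have : (D : K) ^ k * x ∈ (algebraMap (𝓞 K) K).range := by
      refine HeightOneSpectrum.mem_integers_of_valuation_le_one K _ fun v => ?_
      by_cases hv : v ∈ S
      · rw [← adicAbv_le_one_iff, map_mul, map_pow]
        exact (mul_le_mul_of_nonneg_left (h3 v hv) (by positivity)).trans (hk v hv)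
      · rw [map_mul, map_pow]
        exact mul_le_one' (pow_le_one' (v.valuation_le_one D) _) (h1 v hv)
    obtain ⟨y, hy⟩ := this
    change IsIntegral ℤ ((D : K) ^ k * x)
    rw [← hy]
    exact y.isIntegral_coe
  · rw [map_mul, norm_mul]
    exact mul_le_mul (hC φ) (h2 φ) (norm_nonneg _) ((norm_nonneg _).trans (hC φ))

/-- The `S`-unit equation `x + y = 1` has only finitely many solutions. -/
theorem finite_sUnit_equation (S : Finset (HeightOneSpectrum (𝓞 K))) :
    {x : K | ∀ v ∉ S, v.valuation K x = 1 ∧ v.valuation K (1 - x) = 1}.Finite := by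
  let a : (K →+* ℂ) ⊕ S → AbsoluteValue K ℝ := Sum.elim NumberField.place fun v => adicAbv K v.1
  let O := ((S : Set (HeightOneSpectrum (𝓞 K))).integer K).toSubring
  have key := finite_unit_equation a O (fun d hd hd0 => by
    rw [Fintype.prod_sum_type]
    exact one_le_prod_place_mul_prod_adicAbv S (fun v hv => hd v hv) hd0)
    (fun B => (finite_sInteger_of_abs_le S B).subset fun x hx =>
      ⟨fun v hv => hx.1 v hv, fun φ => hx.2 (Sum.inl φ), fun v hv => hx.2 (Sum.inr ⟨v, hv⟩)⟩)
  refine (key.union ((Set.finite_singleton 0).union (Set.finite_singleton 1))).subset fun x hx => ?_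
  rw [Set.mem_union, Set.mem_union, Set.mem_singleton_iff, Set.mem_singleton_iff]
  by_cases x0 : x = 0
  · exact Or.inr (Or.inl x0)
  by_cases x1 : x = 1
  · exact Or.inr (Or.inr x1)
  refine Or.inl ⟨⟨x0, fun v hv => (hx v hv).1.le, fun v hv => ?_⟩, sub_ne_zero.2 (Ne.symm x1),
    fun v hv => (hx v hv).2.le, fun v hv => ?_⟩
  · rw [map_inv₀, (hx v hv).1, inv_one]
  · rw [map_inv₀, (hx v hv).2, inv_one]

end SInteger

section PairContent

/-- The largest `v`-adic valuation of the coordinates of `w`. -/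
noncomputable def pairContent (v : HeightOneSpectrum (𝓞 K)) (w : Fin 2 → K) :
    WithZero (Multiplicative ℤ) :=
  max (v.valuation K (w 0)) (v.valuation K (w 1))

/-- The determinant of the matrix with rows `w` and `w'`. -/
def pairDet {F : Type*} [CommRing F] (w w' : Fin 2 → F) : F := w 0 * w' 1 - w 1 * w' 0

theorem pairContent_smul (v : HeightOneSpectrum (𝓞 K)) (a : K) (w : Fin 2 → K) :
    pairContent v (a • w) = v.valuation K a * pairContent v w := by
  simp only [pairContent, Pi.smul_apply, smul_eq_mul, map_mul]
  exact (mul_max _ _ _).symm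

theorem valuation_apply_le_pairContent (v : HeightOneSpectrum (𝓞 K)) (w : Fin 2 → K) (i : Fin 2) :
    v.valuation K (w i) ≤ pairContent v w := by
  fin_cases i
  · exact le_max_left _ _
  · exact le_max_right _ _

theorem pairContent_ne_zero (v : HeightOneSpectrum (𝓞 K)) {w : Fin 2 → K} (hw : w ≠ 0) :
    pairContent v w ≠ 0 := by
  obtain ⟨i, hi⟩ := Function.ne_iff.1 hw
  exact ((zero_lt_iff.2 ((v.valuation K).ne_zero_iff.2 hi)).trans_le
    (valuation_apply_le_pairContent v w i)).ne'

theorem valuation_pairDet_le (v : HeightOneSpectrum (𝓞 K)) (w w' : Fin 2 → K) :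
    v.valuation K (pairDet w w') ≤ pairContent v w * pairContent v w' := by
  refine ((v.valuation K).map_sub _ _).trans (max_le ?_ ?_) <;> rw [map_mul] <;>
  exact mul_le_mul' (valuation_apply_le_pairContent ..) (valuation_apply_le_pairContent ..)

theorem pairDet_smul_smul {F : Type*} [CommRing F] (a b : F) (w w' : Fin 2 → F) :
    pairDet (a • w) (b • w') = a * b * pairDet w w' := by
  simp only [pairDet, Pi.smul_apply, smul_eq_mul]; ring

theorem exists_smul_eq_of_pairDet_eq_zero {F : Type*} [Field F] {w w' : Fin 2 → F} (hw' : w' ≠ 0)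
    (h : pairDet w w' = 0) : ∃ a : F, a • w' = w := by
  rw [pairDet] at h
  obtain ⟨i, hi⟩ := Function.ne_iff.1 hw'
  refine ⟨w i / w' i, funext fun j => ?_⟩
  simp only [Pi.zero_apply] at hi
  rw [Pi.smul_apply, smul_eq_mul]
  fin_cases i <;> fin_cases j <;> simp at hi ⊢ <;> field_simp
  · linear_combination h
  · linear_combination -h

theorem mk_eq_mk_of_pairDet_eq_zero {F : Type*} [Field F] {w w' : Fin 2 → F} (hw : w ≠ 0)
    (hw' : w' ≠ 0) (h : pairDet w w' = 0) :
    Projectivization.mk F w hw = Projectivization.mk F w' hw' :=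
  (Projectivization.mk_eq_mk_iff' F w w' hw hw').2 (exists_smul_eq_of_pairDet_eq_zero hw' h)

theorem pairContent_le_of_span_le (v : HeightOneSpectrum (𝓞 K)) {w w' : Fin 2 → 𝓞 K}
    (h : Ideal.span {w 0, w 1} ≤ Ideal.span {w' 0, w' 1}) :
    pairContent v (fun i => algebraMap (𝓞 K) K (w i)) ≤ pairContent v (fun i => algebraMap (𝓞 K) K (w' i)) := by
  have key : ∀ r ∈ Ideal.span {w' 0, w' 1},
      v.valuation K (algebraMap (𝓞 K) K r) ≤ pairContent v (fun i => algebraMap (𝓞 K) K (w' i)) := by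
    intro r hr
    obtain ⟨a, b, rfl⟩ := Ideal.mem_span_pair.1 hr
    rw [map_add, map_mul, map_mul]
    refine ((v.valuation K).map_add _ _).trans (max_le ?_ ?_) <;> rw [map_mul]
    · exact mul_le_of_le_one_of_le (v.valuation_le_one a) (valuation_apply_le_pairContent v
        (fun i => algebraMap (𝓞 K) K (w' i)) 0)
    · exact mul_le_of_le_one_of_le (v.valuation_le_one b) (valuation_apply_le_pairContent v
        (fun i => algebraMap (𝓞 K) K (w' i)) 1)
  exact max_le (key _ (h (Ideal.subset_span (by simp)))) (key _ (h (Ideal.subset_span (by simp))))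

theorem exists_integral_smul (w : Fin 2 → K) :
    ∃ a : K, a ≠ 0 ∧ ∃ u : Fin 2 → 𝓞 K, a • w = fun i => algebraMap (𝓞 K) K (u i) := by
  obtain ⟨b, hb⟩ := IsLocalization.exist_integer_multiples_of_finite (nonZeroDivisors (𝓞 K)) w
  choose u hu using hb
  refine ⟨algebraMap (𝓞 K) K b, by simp, u, funext fun i => ?_⟩
  rw [hu i, Algebra.smul_def]
  rfl

variable (K) in
/-- By finiteness of the class group, the points of `ℙ¹(K)` have representatives whose contents
take finitely many values. -/
theorem exists_finite_pairContent : ∃ C : Set (HeightOneSpectrum (𝓞 K) → WithZero (Multiplicative ℤ)),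
    C.Finite ∧ ∀ w : Fin 2 → K, w ≠ 0 → ∃ a : K, a ≠ 0 ∧ (fun v => pairContent v (a • w)) ∈ C := by
  let P : ClassGroup (𝓞 K) → (Fin 2 → 𝓞 K) → Prop := fun g u =>
    ∃ h : Ideal.span {u 0, u 1} ∈ nonZeroDivisors (Ideal (𝓞 K)), ClassGroup.mk0 ⟨_, h⟩ = g
  let f : ClassGroup (𝓞 K) → HeightOneSpectrum (𝓞 K) → WithZero (Multiplicative ℤ) := fun g v =>
    if h : ∃ u, P g u then pairContent v (fun i => algebraMap (𝓞 K) K (h.choose i)) else 0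
  refine ⟨Set.range f, Set.finite_range f, fun w hw => ?_⟩
  obtain ⟨b, hb, u, hu⟩ := exists_integral_smul w
  have hu0 : Ideal.span {u 0, u 1} ∈ nonZeroDivisors (Ideal (𝓞 K)) := by
    rw [mem_nonZeroDivisors_iff_ne_zero]
    intro h
    rw [Submodule.zero_eq_bot, Ideal.span_eq_bot] at h
    refine smul_ne_zero hb hw (hu.trans (funext fun i => ?_))
    have : u i = 0 := by fin_cases i <;> exact h _ (by simp)
    simp [this]
  have hex : ∃ u', P (ClassGroup.mk0 ⟨_, hu0⟩) u' := ⟨u, hu0, rfl⟩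
  obtain ⟨h1, h2⟩ := hex.choose_spec
  obtain ⟨x, y, hx, hy, hxy⟩ := ClassGroup.mk0_eq_mk0_iff.1 h2
  have hx' : algebraMap (𝓞 K) K x ≠ 0 := by simpa using hx
  have hy' : algebraMap (𝓞 K) K y ≠ 0 := by simpa using hy
  refine ⟨(algebraMap (𝓞 K) K x)⁻¹ * algebraMap (𝓞 K) K y * b, mul_ne_zero (mul_ne_zero (inv_ne_zero hx') hy') hb,
    ClassGroup.mk0 ⟨_, hu0⟩, funext fun v => ?_⟩
  simp only [f]
  rw [dif_pos hex, mul_smul, hu, mul_smul, pairContent_smul, map_inv₀]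
  have hs : ∀ (z : 𝓞 K) (t : Fin 2 → 𝓞 K),
      Ideal.span {z} * Ideal.span {t 0, t 1} = Ideal.span {(z • t) 0, (z • t) 1} := by
    intro z t
    rw [Ideal.span_mul_span', Set.singleton_mul, Set.image_pair]
    rfl
  simp only [hs] at hxy
  have e : ∀ (z : 𝓞 K) (t : Fin 2 → 𝓞 K),
      (fun i => algebraMap (𝓞 K) K ((z • t) i)) = algebraMap (𝓞 K) K z • fun i => algebraMap (𝓞 K) K (t i) := fun z t => by
    ext i; simp
  have h3 := le_antisymm (pairContent_le_of_span_le (K := K) v hxy.le)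
    (pairContent_le_of_span_le v hxy.ge)
  rw [e, e, pairContent_smul] at h3
  rw [← h3, inv_mul_cancel_left₀ ((v.valuation K).ne_zero_iff.2 hx')]

/-- Every nonzero pair can be completed to a basis whose determinant has the largest valuation
allowed by the contents. -/
theorem exists_pairDet_eq_one {w : Fin 2 → K} (hw : w ≠ 0) :
    ∃ w' : Fin 2 → K, pairDet w w' = 1 ∧ ∀ v, pairContent v w' = (pairContent v w)⁻¹ := by
  let J : FractionalIdeal (nonZeroDivisors (𝓞 K)) K :=
    FractionalIdeal.spanSingleton _ (w 0) + FractionalIdeal.spanSingleton _ (w 1)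
  have hmem : ∀ i, w i ∈ J := by
    intro i
    fin_cases i
    · exact (FractionalIdeal.mem_add ..).2 ⟨_, FractionalIdeal.mem_spanSingleton_self _ _, 0,
        Submodule.zero_mem _, add_zero _⟩
    · exact (FractionalIdeal.mem_add ..).2 ⟨0, Submodule.zero_mem _, _,
        FractionalIdeal.mem_spanSingleton_self _ _, zero_add _⟩
  have hJ : J ≠ 0 := by
    intro h
    refine hw (funext fun i => ?_)
    simpa [h] using hmem i
  have h1 : (1 : K) ∈ J * J⁻¹ := by
    rw [mul_inv_cancel₀ hJ]
    exact FractionalIdeal.one_mem_one _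
  rw [add_mul, FractionalIdeal.mem_add] at h1
  obtain ⟨s, hs, t, ht, hst⟩ := h1
  obtain ⟨y, hy, rfl⟩ := FractionalIdeal.mem_singleton_mul.1 hs
  obtain ⟨z, hz, rfl⟩ := FractionalIdeal.mem_singleton_mul.1 ht
  have hle : ∀ (v : HeightOneSpectrum (𝓞 K)), ∀ x ∈ J⁻¹,
      v.valuation K x ≤ (pairContent v w)⁻¹ := by
    intro v x hx
    have hi : ∀ i, v.valuation K x * v.valuation K (w i) ≤ 1 := by
      intro i
      have := (FractionalIdeal.mem_inv_iff hJ).1 hx _ (hmem i)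
      obtain ⟨r, hr⟩ := (FractionalIdeal.mem_one_iff _).1 this
      rw [← map_mul, ← hr]
      exact v.valuation_le_one r
    rw [← one_div, le_div_iff₀ (zero_lt_iff.2 (pairContent_ne_zero v hw)), pairContent,
      mul_max]
    exact max_le (hi 0) (hi 1)
  have hdet : pairDet w ![-z, y] = 1 := by
    rw [← hst]
    simp [pairDet]
  refine ⟨![-z, y], hdet, fun v => le_antisymm ?_ ?_⟩
  · refine max_le ?_ (hle v y hy)
    simpa using hle v z hz
  · have := valuation_pairDet_le v w ![-z, y]
    rw [hdet, map_one] at this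
    rw [mul_comm] at this
    exact (inv_le_iff_one_le_mul₀ (zero_lt_iff.2 (pairContent_ne_zero v hw))).2 this

theorem exists_primitive_rep (v : HeightOneSpectrum (𝓞 K)) {w : Fin 2 → K} (hw : w ≠ 0) :
    ∃ a : K, a ≠ 0 ∧ ∃ u : Fin 2 → 𝓞 K, (a • w = fun i => algebraMap (𝓞 K) K (u i)) ∧ ∃ i, u i ∉ v.asIdeal := by
  have key : ∀ s t : K, t ≠ 0 → ∃ a : K, a ≠ 0 ∧ ∃ p q : 𝓞 K, a * s = algebraMap (𝓞 K) K p ∧ a * t = algebraMap (𝓞 K) K q ∧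
      (p ∉ v.asIdeal ∨ q ∉ v.asIdeal) := by
    intro s t ht
    obtain ⟨n, d, h | h⟩ := v.exists_primeCompl_mul_eq_or_mul_eq (s / t)
    · refine ⟨algebraMap (𝓞 K) K d / t, div_ne_zero ?_ ht, n, d, ?_, ?_, Or.inr d.2⟩
      · have : (d : 𝓞 K) ≠ 0 := fun h0 => d.2 (by rw [h0]; exact zero_mem _)
        simpa using this
      · rw [← h]; field_simp
      · field_simp
    · have hd : algebraMap (𝓞 K) K d ≠ 0 := by
        have : (d : 𝓞 K) ≠ 0 := fun h0 => d.2 (by rw [h0]; exact zero_mem _)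
        simpa using this
      refine ⟨algebraMap (𝓞 K) K n / t, div_ne_zero (fun h0 => hd ?_) ht, d, n, ?_, ?_, Or.inl d.2⟩
      · rw [← h, h0, mul_zero]
      · rw [← h]; field_simp
      · field_simp
  obtain ⟨i, hi⟩ := Function.ne_iff.1 hw
  obtain ⟨a, ha, p, q, h1, h2, h3⟩ := key (w (1 - i)) (w i) hi
  fin_cases i
  · refine ⟨a, ha, ![q, p], ?_, ?_⟩
    · ext j; fin_cases j
      · simpa using h2
      · simpa using h1
    · exact h3.elim (fun h => ⟨1, h⟩) fun h => ⟨0, h⟩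
  · refine ⟨a, ha, ![p, q], ?_, ?_⟩
    · ext j; fin_cases j
      · simpa using h1
      · simpa using h2
    · exact h3.elim (fun h => ⟨0, h⟩) fun h => ⟨1, h⟩

theorem pairContent_eq_one (v : HeightOneSpectrum (𝓞 K)) {u : Fin 2 → 𝓞 K}
    (h : (fun i => Ideal.Quotient.mk v.asIdeal (u i)) ≠ 0) :
    pairContent v (fun i => algebraMap (𝓞 K) K (u i)) = 1 := by
  obtain ⟨i, hi⟩ := Function.ne_iff.1 h
  refine le_antisymm (max_le (v.valuation_le_one _) (v.valuation_le_one _)) ?_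
  refine le_trans (le_of_eq ?_) (valuation_apply_le_pairContent v _ i)
  refine (v.valuation_eq_one_iff_notMem.2 fun hm => hi ?_).symm
  exact Ideal.Quotient.eq_zero_iff_mem.2 hm

end PairContent

section Orbits

/-- The image of a point under reduction has a primitive integral representative. -/
theorem exists_rep_redMap (v : HeightOneSpectrum (𝓞 K)) (x : ℙ K (Fin 2 → K)) :
    ∃ (w : Fin 2 → 𝓞 K) (hw : (fun i => algebraMap (𝓞 K) K (w i)) ≠ 0)
      (hw' : (fun i => Ideal.Quotient.mk v.asIdeal (w i)) ≠ 0),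
      x = Projectivization.mk K (fun i => algebraMap (𝓞 K) K (w i)) hw ∧
      redMap v x = Projectivization.mk (𝓞 K ⧸ v.asIdeal)
        (fun i => Ideal.Quotient.mk v.asIdeal (w i)) hw' := by
  have h : ∃ y : ℙ (𝓞 K ⧸ v.asIdeal) (Fin 2 → 𝓞 K ⧸ v.asIdeal),
      ∃ (w : Fin 2 → 𝓞 K) (hw : (fun i => algebraMap (𝓞 K) K (w i)) ≠ 0)
        (hw' : (fun i => Ideal.Quotient.mk v.asIdeal (w i)) ≠ 0),
      x = Projectivization.mk K (fun i => algebraMap (𝓞 K) K (w i)) hw ∧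
      y = Projectivization.mk (𝓞 K ⧸ v.asIdeal)
        (fun i => Ideal.Quotient.mk v.asIdeal (w i)) hw' := by
    induction x with | h w hw
    obtain ⟨a, ha, u, hu, i, hi⟩ := exists_primitive_rep v hw
    have hu0 : (fun i => algebraMap (𝓞 K) K (u i)) ≠ 0 := hu ▸ smul_ne_zero ha hw
    refine ⟨_, u, hu0, fun h => hi (Ideal.Quotient.eq_zero_iff_mem.1 (congrFun h i)), ?_, rfl⟩
    rw [Projectivization.mk_eq_mk_iff']
    refine ⟨a⁻¹, ?_⟩
    rw [← hu, inv_smul_smul₀ ha]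
  rw [redMap, dif_pos h]
  exact h.choose_spec

/-- Points with distinct reductions have a determinant of the largest possible valuation. -/
theorem valuation_pairDet_eq_of_redMap_ne (v : HeightOneSpectrum (𝓞 K)) {w w' : Fin 2 → K}
    (hw : w ≠ 0) (hw' : w' ≠ 0)
    (h : redMap v (Projectivization.mk K w hw) ≠ redMap v (Projectivization.mk K w' hw')) :
    v.valuation K (pairDet w w') = pairContent v w * pairContent v w' := by
  obtain ⟨u, hu, hur, e1, e2⟩ := exists_rep_redMap v (Projectivization.mk K w hw)
  obtain ⟨u', hu', hur', e1', e2'⟩ := exists_rep_redMap v (Projectivization.mk K w' hw')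
  obtain ⟨a, rfl⟩ := (Projectivization.mk_eq_mk_iff' K _ _ _ _).1 e1
  obtain ⟨b, rfl⟩ := (Projectivization.mk_eq_mk_iff' K _ _ _ _).1 e1'
  rw [e2, e2'] at h
  have hd : pairDet u u' ∉ v.asIdeal := by
    intro hm
    refine h (mk_eq_mk_of_pairDet_eq_zero _ _ ?_)
    rw [← Ideal.Quotient.eq_zero_iff_mem] at hm
    simpa only [pairDet, map_sub, map_mul] using hm
  have hd' : pairDet (fun i => algebraMap (𝓞 K) K (u i)) (fun i => algebraMap (𝓞 K) K (u' i)) =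
      algebraMap (𝓞 K) K (pairDet u u') := by
    simp only [pairDet, map_sub, map_mul]
  rw [pairDet_smul_smul, pairContent_smul, pairContent_smul, pairContent_eq_one v hur,
    pairContent_eq_one v hur', hd', map_mul, map_mul, v.valuation_eq_one_iff_notMem.2 hd,
    mul_one, mul_one, mul_one]

theorem glPt_mk {F : Type*} [Field F] (g : GL (Fin 2) F) {w : Fin 2 → F} (hw : w ≠ 0)
    (hw' : Matrix.vecMul w (g : Matrix (Fin 2) (Fin 2) F) ≠ 0) :
    glPt g (Projectivization.mk F w hw) = Projectivization.mk F _ hw' := by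
  obtain ⟨a, ha⟩ := Projectivization.exists_smul_eq_mk_rep F w hw
  rw [glPt, Projectivization.mk_eq_mk_iff]
  refine ⟨a, ?_⟩
  rw [← ha, Units.smul_def, Units.smul_def, Matrix.smul_vecMul]

/-- A frame `w₀`, `w₁` of `K²` whose vectors have contents `c.1` and `c.2` outside `S` and whose
determinant has the largest possible valuation there. -/
structure IsFrame (S : Finset (HeightOneSpectrum (𝓞 K)))
    (c : (HeightOneSpectrum (𝓞 K) → WithZero (Multiplicative ℤ)) ×
      (HeightOneSpectrum (𝓞 K) → WithZero (Multiplicative ℤ))) (w₀ w₁ : Fin 2 → K) : Prop where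
  det_ne_zero : pairDet w₀ w₁ ≠ 0
  content_fst : ∀ v ∉ S, pairContent v w₀ = c.1 v
  content_snd : ∀ v ∉ S, pairContent v w₁ = c.2 v
  valuation_det : ∀ v ∉ S, v.valuation K (pairDet w₀ w₁) = c.1 v * c.2 v

/-- Frames with the same contents are related by a matrix over the `S`-integers. -/
theorem IsFrame.exists_vecMul_eq {S : Finset (HeightOneSpectrum (𝓞 K))}
    {c : (HeightOneSpectrum (𝓞 K) → WithZero (Multiplicative ℤ)) ×
      (HeightOneSpectrum (𝓞 K) → WithZero (Multiplicative ℤ))} {w₀ w₁ w₀' w₁' : Fin 2 → K}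
    (h : IsFrame S c w₀ w₁) (h' : IsFrame S c w₀' w₁') :
    ∃ γ : GL (Fin 2) ↥((S : Set (HeightOneSpectrum (𝓞 K))).integer K),
      Matrix.vecMul w₀ (Matrix.GeneralLinearGroup.map
        ((S : Set (HeightOneSpectrum (𝓞 K))).integer K).val.toRingHom γ : Matrix _ _ K) = w₀' ∧
      Matrix.vecMul w₁ (Matrix.GeneralLinearGroup.map
        ((S : Set (HeightOneSpectrum (𝓞 K))).integer K).val.toRingHom γ : Matrix _ _ K) = w₁' := by
  obtain ⟨D, hD⟩ : ∃ D, D = pairDet w₀ w₁ := ⟨_, rfl⟩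
  have hD0 : D ≠ 0 := hD ▸ h.det_ne_zero
  have hval : ∀ v ∉ S, v.valuation K D ≠ 0 := fun v _ =>
    (v.valuation K).ne_zero_iff.2 hD0
  let M : Matrix (Fin 2) (Fin 2) K := fun j k =>
    (![w₁ 1, -w₁ 0] j * w₀' k + ![-w₀ 1, w₀ 0] j * w₁' k) / D
  have hM : ∀ j k, M j k ∈ (S : Set (HeightOneSpectrum (𝓞 K))).integer K := by
    intro j k v hv
    have hv' : v ∉ S := by simpa using hv
    change v.valuation K (M j k) ≤ 1
    simp only [M]
    rw [map_div₀, div_le_one₀ (zero_lt_iff.2 (hval v hv')), hD, h.valuation_det v hv']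
    refine ((v.valuation K).map_add _ _).trans (max_le ?_ ?_)
    · rw [map_mul, mul_comm, ← h'.content_fst v hv', ← h.content_snd v hv']
      refine mul_le_mul' (valuation_apply_le_pairContent ..) ?_
      fin_cases j
      · exact valuation_apply_le_pairContent v w₁ 1
      · simpa using valuation_apply_le_pairContent v w₁ 0
    · rw [map_mul, ← h.content_fst v hv', ← h'.content_snd v hv']
      refine mul_le_mul' ?_ (valuation_apply_le_pairContent ..)
      fin_cases j
      · simpa using valuation_apply_le_pairContent v w₀ 1
      · exact valuation_apply_le_pairContent v w₀ 0
  let A : Matrix (Fin 2) (Fin 2) ↥((S : Set (HeightOneSpectrum (𝓞 K))).integer K) :=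
    fun j k => ⟨M j k, hM j k⟩
  have hdet : (A.det : K) = pairDet w₀' w₁' / D := by
    rw [Matrix.det_fin_two]
    change ((w₁ 1 * w₀' 0 + -w₀ 1 * w₁' 0) / D) * ((-w₁ 0 * w₀' 1 + w₀ 0 * w₁' 1) / D) -
      ((w₁ 1 * w₀' 1 + -w₀ 1 * w₁' 1) / D) * ((-w₁ 0 * w₀' 0 + w₀ 0 * w₁' 0) / D) = _
    rw [pairDet]
    field_simp
    rw [hD, pairDet]
    ring
  have hu : IsUnit A.det := by
    have hmem : D / pairDet w₀' w₁' ∈ (S : Set (HeightOneSpectrum (𝓞 K))).integer K := by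
      intro v hv
      have hv' : v ∉ S := by simpa using hv
      change v.valuation K _ ≤ 1
      rw [map_div₀, hD, h.valuation_det v hv', h'.valuation_det v hv']
      exact div_self_le_one _
    refine IsUnit.of_mul_eq_one ⟨_, hmem⟩ (Subtype.ext ?_)
    change (A.det : K) * (D / pairDet w₀' w₁') = 1
    rw [hdet, div_mul_div_cancel₀ hD0, div_self h'.det_ne_zero]
  have hentry : ∀ j k, (Matrix.GeneralLinearGroup.map
      ((S : Set (HeightOneSpectrum (𝓞 K))).integer K).val.toRingHom
      (Matrix.GeneralLinearGroup.mk'' A hu) : Matrix _ _ K) j k = M j k := fun j k => rfl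
  refine ⟨Matrix.GeneralLinearGroup.mk'' A hu, funext fun k => ?_, funext fun k => ?_⟩
  · simp only [Matrix.vecMul, dotProduct, Fin.sum_univ_two, hentry]
    simp only [M, Matrix.cons_val_zero, Matrix.cons_val_one]
    field_simp
    rw [hD, pairDet]
    ring
  · simp only [Matrix.vecMul, dotProduct, Fin.sum_univ_two, hentry]
    simp only [M, Matrix.cons_val_zero, Matrix.cons_val_one]
    field_simp
    rw [hD, pairDet]
    ring

/-- The points with coordinates in `L` with respect to `w₀`, `w₁`. -/
def framePoints {F : Type*} [Field F] (L : Set (F × F)) (w₀ w₁ : Fin 2 → F) :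
    Set (ℙ F (Fin 2 → F)) :=
  {x | ∃ p ∈ L, ∃ h, x = Projectivization.mk F (p.1 • w₀ + p.2 • w₁) h}

theorem glPt_image_framePoints {F : Type*} [Field F] (g : GL (Fin 2) F) (L : Set (F × F))
    (w₀ w₁ : Fin 2 → F) :
    glPt g '' framePoints L w₀ w₁ = framePoints L
      (Matrix.vecMul w₀ (g : Matrix (Fin 2) (Fin 2) F))
      (Matrix.vecMul w₁ (g : Matrix (Fin 2) (Fin 2) F)) := by
  have hlin : ∀ p : F × F, Matrix.vecMul (p.1 • w₀ + p.2 • w₁) (g : Matrix (Fin 2) (Fin 2) F) =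
      p.1 • Matrix.vecMul w₀ (g : Matrix (Fin 2) (Fin 2) F) +
        p.2 • Matrix.vecMul w₁ (g : Matrix (Fin 2) (Fin 2) F) := fun p => by
    rw [Matrix.add_vecMul, Matrix.smul_vecMul, Matrix.smul_vecMul]
  have hinj : ∀ u : Fin 2 → F, Matrix.vecMul u (g : Matrix (Fin 2) (Fin 2) F) = 0 ↔ u = 0 := by
    refine fun u => ⟨fun h => ?_, fun h => by rw [h, Matrix.zero_vecMul]⟩
    have := congrArg (fun t => Matrix.vecMul t ((g⁻¹ : GL (Fin 2) F) : Matrix (Fin 2) (Fin 2) F)) h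
    simpa only [Matrix.vecMul_vecMul, ← Units.val_mul, mul_inv_cancel, Units.val_one,
      Matrix.vecMul_one, Matrix.zero_vecMul] using this
  ext x
  constructor
  · rintro ⟨_, ⟨p, hp, h, rfl⟩, rfl⟩
    have h' := mt (hinj _).1 h
    rw [glPt_mk g h h']
    simp only [hlin]
    exact ⟨p, hp, hlin p ▸ h', rfl⟩
  · rintro ⟨p, hp, h, rfl⟩
    have h' : p.1 • w₀ + p.2 • w₁ ≠ 0 := mt (hinj _).2 (hlin p ▸ h)
    refine ⟨_, ⟨p, hp, h', rfl⟩, ?_⟩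
    rw [glPt_mk g h' (mt (hinj _).1 h')]
    simp only [hlin]

end Orbits

section Frames

theorem pairDet_smul_eq {F : Type*} [CommRing F] (a b c : Fin 2 → F) :
    pairDet a b • c = pairDet c b • a + pairDet a c • b := by
  ext i
  fin_cases i <;> simp [pairDet] <;> ring

theorem exists_eq_framePoints {F : Type*} [Field F] {L₀ : Set (F × F)} {w₀ w₁ : Fin 2 → F}
    {A : Set (ℙ F (Fin 2 → F))} (h : A ⊆ framePoints L₀ w₀ w₁) :
    ∃ L ⊆ L₀, A = framePoints L w₀ w₁ := by
  refine ⟨{p ∈ L₀ | ∃ h, Projectivization.mk F (p.1 • w₀ + p.2 • w₁) h ∈ A},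
    fun p hp => hp.1, Set.Subset.antisymm (fun x hx => ?_) ?_⟩
  · obtain ⟨p, hp, h0, rfl⟩ := h hx
    exact ⟨p, ⟨hp, h0, hx⟩, h0, rfl⟩
  · rintro _ ⟨p, ⟨-, h0, hp⟩, -, rfl⟩
    exact hp

theorem projMk_smul {F : Type*} [Field F] {a : F} {w : Fin 2 → F} (hw : w ≠ 0) (h : a • w ≠ 0) :
    Projectivization.mk F w hw = Projectivization.mk F (a • w) h :=
  ((Projectivization.mk_eq_mk_iff' F _ _ _ _).2 ⟨a, rfl⟩).symm

theorem pairDet_ne_zero_of_mk_ne {F : Type*} [Field F] {w w' : Fin 2 → F} {hw : w ≠ 0}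
    {hw' : w' ≠ 0} (h : Projectivization.mk F w hw ≠ Projectivization.mk F w' hw') :
    pairDet w w' ≠ 0 :=
  mt (mk_eq_mk_of_pairDet_eq_zero hw hw') h

theorem valuation_pairDet_of_mem_OmegaSet {S : Finset (HeightOneSpectrum (𝓞 K))} {n : ℕ}
    {A : Set (ℙ K (Fin 2 → K))} (hA : A ∈ OmegaSet S n) {w w' : Fin 2 → K} {hw : w ≠ 0}
    {hw' : w' ≠ 0} (h : Projectivization.mk K w hw ∈ A) (h' : Projectivization.mk K w' hw' ∈ A)
    (hne : Projectivization.mk K w hw ≠ Projectivization.mk K w' hw') :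
    ∀ v ∉ S, v.valuation K (pairDet w w') = pairContent v w * pairContent v w' := fun v hv =>
  valuation_pairDet_eq_of_redMap_ne v hw hw' fun he => hne (hA.2.2 v hv h h' he)

theorem isFrame_of_mem_OmegaSet {S : Finset (HeightOneSpectrum (𝓞 K))} {n : ℕ}
    {A : Set (ℙ K (Fin 2 → K))} (hA : A ∈ OmegaSet S n) {w w' : Fin 2 → K} {hw : w ≠ 0}
    {hw' : w' ≠ 0} (h : Projectivization.mk K w hw ∈ A) (h' : Projectivization.mk K w' hw' ∈ A)
    (hne : Projectivization.mk K w hw ≠ Projectivization.mk K w' hw') :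
    IsFrame S (fun v => pairContent v w, fun v => pairContent v w') w w' :=
  ⟨pairDet_ne_zero_of_mk_ne hne, fun _ _ => rfl, fun _ _ => rfl,
    valuation_pairDet_of_mem_OmegaSet hA h h' hne⟩

/-- A set in `Ω` with three distinct points has a frame with equal contents such that all its
points have coordinates built from solutions of the `S`-unit equation. -/
theorem exists_frame_of_three_points {S : Finset (HeightOneSpectrum (𝓞 K))} {n : ℕ}
    {A : Set (ℙ K (Fin 2 → K))} (hA : A ∈ OmegaSet S n) {w₀ : Fin 2 → K} (hw₀ : w₀ ≠ 0)
    {x₁ x₂ : ℙ K (Fin 2 → K)} (h0 : Projectivization.mk K w₀ hw₀ ∈ A) (h1 : x₁ ∈ A) (h2 : x₂ ∈ A)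
    (h01 : Projectivization.mk K w₀ hw₀ ≠ x₁) (h02 : Projectivization.mk K w₀ hw₀ ≠ x₂)
    (h12 : x₁ ≠ x₂) :
    ∃ w₁, IsFrame S (fun v => pairContent v w₀, fun v => pairContent v w₀) w₀ w₁ ∧
      A ⊆ framePoints ({(1, 0), (0, 1), (1, 1)} ∪ (fun l => (1, l)) ''
        {l : K | ∀ v ∉ S, v.valuation K l = 1 ∧ v.valuation K (1 - l) = 1}) w₀ w₁ := by
  obtain ⟨w₁, hw₁, hw₂, rfl, rfl⟩ : ∃ w₁, ∃ (hw₁ : w₁ ≠ 0) (hw₂ : w₀ + w₁ ≠ 0),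
      x₁ = Projectivization.mk K w₁ hw₁ ∧ x₂ = Projectivization.mk K (w₀ + w₁) hw₂ := by
    induction x₁ with | h u₁ hu₁
    induction x₂ with | h u₂ hu₂
    have d1 := pairDet_ne_zero_of_mk_ne h01
    have d2 := pairDet_ne_zero_of_mk_ne h02
    have d3 := pairDet_ne_zero_of_mk_ne h12.symm
    have e : w₀ + (pairDet w₀ u₂ / pairDet u₂ u₁) • u₁ = (pairDet w₀ u₁ / pairDet u₂ u₁) • u₂ := by
      rw [div_eq_inv_mul, div_eq_inv_mul, mul_smul, mul_smul, pairDet_smul_eq w₀ u₁ u₂, smul_add,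
        inv_smul_smul₀ d3]
    have hw₁ := smul_ne_zero (div_ne_zero d2 d3) hu₁
    have hw₂ := smul_ne_zero (div_ne_zero d1 d3) hu₂
    refine ⟨_, hw₁, e ▸ hw₂, projMk_smul _ _, ?_⟩
    simp only [e]
    exact projMk_smul _ _
  have hD := pairDet_ne_zero_of_mk_ne h01
  have hc : ∀ v ∉ S, pairContent v w₁ = pairContent v w₀ ∧
      pairContent v (w₀ + w₁) = pairContent v w₀ := by
    intro v hv
    have v01 := valuation_pairDet_of_mem_OmegaSet hA h0 h1 h01 v hv
    have v02 := valuation_pairDet_of_mem_OmegaSet hA h0 h2 h02 v hv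
    have v12 := valuation_pairDet_of_mem_OmegaSet hA h1 h2 h12 v hv
    have e02 : pairDet w₀ (w₀ + w₁) = pairDet w₀ w₁ := by simp [pairDet]; ring
    have e12 : pairDet w₁ (w₀ + w₁) = -pairDet w₀ w₁ := by simp [pairDet]; ring
    rw [e02, v01] at v02
    rw [e12, Valuation.map_neg, v01] at v12
    have c12 := mul_left_cancel₀ (pairContent_ne_zero v hw₀) v02
    rw [← c12] at v12 ⊢
    have c01 := mul_right_cancel₀ (pairContent_ne_zero v hw₁) v12
    exact ⟨c01.symm, c01.symm⟩
  refine ⟨w₁, ⟨hD, fun _ _ => rfl, fun v hv => (hc v hv).1, fun v hv => ?_⟩, fun x hx => ?_⟩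
  · rw [valuation_pairDet_of_mem_OmegaSet hA h0 h1 h01 v hv, (hc v hv).1]
  by_cases hx0 : x = Projectivization.mk K w₀ hw₀
  · exact ⟨(1, 0), by simp, by simpa using hw₀, by simpa using hx0⟩
  by_cases hx1 : x = Projectivization.mk K w₁ hw₁
  · exact ⟨(0, 1), by simp, by simpa using hw₁, by simpa using hx1⟩
  by_cases hx2 : x = Projectivization.mk K (w₀ + w₁) hw₂
  · exact ⟨(1, 1), by simp, by simpa using hw₂, by simpa using hx2⟩
  obtain ⟨l, hl, rfl⟩ : ∃ l : K, ∃ hl : w₀ + l • w₁ ≠ 0,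
      x = Projectivization.mk K (w₀ + l • w₁) hl := by
    induction x with | h u hu
    have d := pairDet_ne_zero_of_mk_ne hx1
    have e : w₀ + (pairDet w₀ u / pairDet u w₁) • w₁ = (pairDet w₀ w₁ / pairDet u w₁) • u := by
      rw [div_eq_inv_mul, div_eq_inv_mul, mul_smul, mul_smul, pairDet_smul_eq w₀ w₁ u, smul_add,
        inv_smul_smul₀ d]
    refine ⟨_, e ▸ smul_ne_zero (div_ne_zero hD d) hu, ?_⟩
    simp only [e]
    exact projMk_smul _ _
  refine ⟨(1, l), Or.inr ⟨l, fun v hv => ?_, rfl⟩, by simpa using hl, by simp⟩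
  have v01 := valuation_pairDet_of_mem_OmegaSet hA h0 h1 h01 v hv
  have v0 := valuation_pairDet_of_mem_OmegaSet hA h0 hx (Ne.symm hx0) v hv
  have v1 := valuation_pairDet_of_mem_OmegaSet hA h1 hx (Ne.symm hx1) v hv
  have v2 := valuation_pairDet_of_mem_OmegaSet hA h2 hx (Ne.symm hx2) v hv
  have e0 : pairDet w₀ (w₀ + l • w₁) = l * pairDet w₀ w₁ := by simp [pairDet]; ring
  have e1 : pairDet w₁ (w₀ + l • w₁) = -pairDet w₀ w₁ := by simp [pairDet]; ring
  have e2 : pairDet (w₀ + w₁) (w₀ + l • w₁) = -((1 - l) * pairDet w₀ w₁) := by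
    simp [pairDet]; ring
  have hDv := (v.valuation K).ne_zero_iff.2 hD
  rw [e1, Valuation.map_neg] at v1
  rw [e0, map_mul, ← (hc v hv).1, ← v1] at v0
  rw [e2, Valuation.map_neg, map_mul, (hc v hv).2, ← (hc v hv).1, ← v1] at v2
  exact ⟨(mul_eq_right₀ hDv).1 v0, (mul_eq_right₀ hDv).1 v2⟩

theorem exists_finite_frames (S : Finset (HeightOneSpectrum (𝓞 K))) {n : ℕ} (hn : 1 ≤ n) :
    ∃ (C : Set ((HeightOneSpectrum (𝓞 K) → WithZero (Multiplicative ℤ)) ×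
        (HeightOneSpectrum (𝓞 K) → WithZero (Multiplicative ℤ)))) (L₀ : Set (K × K)),
      C.Finite ∧ L₀.Finite ∧ ∀ A ∈ OmegaSet S n, ∃ c ∈ C, ∃ w₀ w₁, IsFrame S c w₀ w₁ ∧
        A ⊆ framePoints L₀ w₀ w₁ := by
  obtain ⟨C, hC, hrep⟩ := exists_finite_pairContent K
  have hpt : ∀ x : ℙ K (Fin 2 → K), ∃ (w : Fin 2 → K) (hw : w ≠ 0),
      x = Projectivization.mk K w hw ∧ (fun v => pairContent v w) ∈ C := by
    intro x
    induction x with | h u hu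
    obtain ⟨a, ha, hau⟩ := hrep u hu
    exact ⟨a • u, smul_ne_zero ha hu, projMk_smul _ _, hau⟩
  refine ⟨C ×ˢ C ∪ (fun c => (c, fun v => (c v)⁻¹)) '' C,
    {(1, 0), (0, 1), (1, 1)} ∪ (fun l => (1, l)) ''
      {l : K | ∀ v ∉ S, v.valuation K l = 1 ∧ v.valuation K (1 - l) = 1},
    (hC.prod hC).union (hC.image _),
    (Set.toFinite _).union ((finite_sUnit_equation S).image _), fun A hA => ?_⟩
  have hfin := hA.1
  have hcard := hA.2.1
  rcases (by omega : n = 1 ∨ n = 2 ∨ 2 < n) with h | h | h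
  · obtain ⟨x, rfl⟩ := Set.ncard_eq_one.1 (hcard.trans h)
    obtain ⟨w₀, hw₀, rfl, hc⟩ := hpt x
    obtain ⟨w₁, hdet, hw₁⟩ := exists_pairDet_eq_one hw₀
    refine ⟨_, Or.inr ⟨_, hc, rfl⟩, w₀, w₁, ⟨by simp [hdet], fun _ _ => rfl,
      fun v _ => hw₁ v, fun v _ => ?_⟩, ?_⟩
    · rw [hdet, map_one]
      exact (mul_inv_cancel₀ (pairContent_ne_zero v hw₀)).symm
    · rintro _ rfl
      exact ⟨(1, 0), by simp, by simpa using hw₀, by simp⟩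
  · obtain ⟨x, y, hxy, rfl⟩ := Set.ncard_eq_two.1 (hcard.trans h)
    obtain ⟨w₀, hw₀, rfl, hc₀⟩ := hpt x
    obtain ⟨w₁, hw₁, rfl, hc₁⟩ := hpt y
    refine ⟨_, Or.inl ⟨hc₀, hc₁⟩, w₀, w₁, isFrame_of_mem_OmegaSet hA (by simp) (by simp) hxy, ?_⟩
    rintro _ (rfl | rfl)
    · exact ⟨(1, 0), by simp, by simpa using hw₀, by simp⟩
    · exact ⟨(0, 1), by simp, by simpa using hw₁, by simp⟩
  · obtain ⟨x, y, z, hx, hy, hz, hxy, hxz, hyz⟩ :=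
      (Set.two_lt_ncard_iff hfin).1 (hcard.symm ▸ h)
    obtain ⟨w₀, hw₀, rfl, hc⟩ := hpt x
    obtain ⟨w₁, hw₁, hsub⟩ := exists_frame_of_three_points hA hw₀ hx hy hz hxy hxz hyz
    exact ⟨_, Or.inl ⟨hc, hc⟩, w₀, w₁, hw₁, hsub⟩

end Frames

/-- `Ω_{n,K}(ℙ¹;S)` decomposes into finitely many orbits under the
action of `GL₂(𝒪_{K,S})`. -/
theorem finitely_many_GL2_orbits_on_Omega
    (K : Type*) [Field K] [NumberField K]
    (S : Finset (HeightOneSpectrum (𝓞 K))) (n : ℕ) (hn : 1 ≤ n) :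
    ∃ R : Set (Set (ℙ K (Fin 2 → K))),
      R.Finite ∧ R ⊆ OmegaSet S n ∧
      ∀ A ∈ OmegaSet S n, ∃ B ∈ R,
        ∃ γ : GL (Fin 2) ↥((S : Set (HeightOneSpectrum (𝓞 K))).integer K),
          A = glPt (Matrix.GeneralLinearGroup.map
              ((S : Set (HeightOneSpectrum (𝓞 K))).integer K).val.toRingHom γ) '' B := by
  obtain ⟨C, L₀, hC, hL₀, hframe⟩ := exists_finite_frames S hn
  let P := fun (t : ((HeightOneSpectrum (𝓞 K) → WithZero (Multiplicative ℤ)) ×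
      (HeightOneSpectrum (𝓞 K) → WithZero (Multiplicative ℤ))) × Set (K × K))
      (A : Set (ℙ K (Fin 2 → K))) =>
    A ∈ OmegaSet S n ∧ ∃ w₀ w₁, IsFrame S t.1 w₀ w₁ ∧ A = framePoints t.2 w₀ w₁
  choose! f hf using fun t (ht : ∃ A, P t A) => ht
  refine ⟨f '' {t ∈ C ×ˢ 𝒫 L₀ | ∃ A, P t A}, ((hC.prod hL₀.powerset).subset
    fun t ht => ht.1).image f, ?_, fun A hA => ?_⟩
  · rintro _ ⟨t, ht, rfl⟩
    exact (hf t ht.2).1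
  · obtain ⟨c, hc, w₀, w₁, hw, hsub⟩ := hframe A hA
    obtain ⟨L, hL, rfl⟩ := exists_eq_framePoints hsub
    have hP : ∃ A, P (c, L) A := ⟨_, hA, w₀, w₁, hw, rfl⟩
    refine ⟨_, ⟨(c, L), ⟨⟨hc, hL⟩, hP⟩, rfl⟩, ?_⟩
    obtain ⟨-, u₀, u₁, hu, hfu⟩ := hf _ hP
    obtain ⟨γ, h0, h1⟩ := hu.exists_vecMul_eq hw
    refine ⟨γ, ?_⟩
    rw [hfu, glPt_image_framePoints, h0, h1]
end

section
/- Let α, β, α', β' ∈ O_{K,S} with αβ' − α'β ≠ 0, and suppose the two-element set A = {[α:β], [α':β']} belongs to Ω_{2,K}(ℙ¹;S). Then the ideal identity (αO_{K,S} + βO_{K,S})·(α'O_{K,S} + β'O_{K,S}) = (αβ' − α'β)O_{K,S} holds in O_{K,S}; consequently the binary quadratic form φ_A(x,y) = (αβ' − α'β)^{-1}(βx − αy)(β'x − α'y) has all its coefficients in O_{K,S} and has discriminant Δ(φ_A) = 1. -/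
open Classical IsDedekindDomain NumberField
open scoped LinearAlgebra.Projectivization MatrixGroups

attribute [local instance] Ideal.Quotient.field

set_option synthInstance.maxHeartbeats 1000000
set_option maxHeartbeats 1000000

variable {K : Type*} [Field K] [NumberField K]

/-- In the projective line, equality of points is vanishing of the `2 × 2` determinant. -/
theorem projLine_mk_eq_mk_iff {F : Type*} [Field F] {u w : Fin 2 → F} (hu : u ≠ 0) (hw : w ≠ 0) :
    Projectivization.mk F u hu = Projectivization.mk F w hw ↔ u 0 * w 1 = w 0 * u 1 := by
  rw [Projectivization.mk_eq_mk_iff']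
  constructor
  · rintro ⟨a, rfl⟩
    simp only [Pi.smul_apply, smul_eq_mul]
    ring
  · intro h
    by_cases h0 : w 0 = 0
    · have h1 : w 1 ≠ 0 := fun h1 => hw (by ext i; fin_cases i <;> simp [h0, h1])
      have hu0 : u 0 = 0 := by simpa [h0, h1] using h
      refine ⟨u 1 / w 1, ?_⟩
      ext i
      fin_cases i <;> simp [h0, h1, hu0]
    · refine ⟨u 0 / w 0, ?_⟩
      ext i
      fin_cases i
      · simp [h0]
      · simp only [Fin.mk_one, Pi.smul_apply, smul_eq_mul]
        field_simp
        linear_combination h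

/-- A pair of elements of `K`, not both zero, is a multiple of a pair of integers
not both in `v`. -/
theorem exists_eq_mul_primitive (v : HeightOneSpectrum (𝓞 K)) {a b : K}
    (hab : ![a, b] ≠ 0) :
    ∃ (l : K) (w : Fin 2 → 𝓞 K), l ≠ 0 ∧ a = l * algebraMap (𝓞 K) K (w 0) ∧
      b = l * algebraMap (𝓞 K) K (w 1) ∧ (fun i => Ideal.Quotient.mk v.asIdeal (w i)) ≠ 0 := by
  by_cases ha : a = 0
  · have hb : b ≠ 0 := fun hb => hab (by simp [ha, hb])
    refine ⟨b, ![0, 1], hb, by simp [ha], by simp, fun h => ?_⟩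
    simpa using congrFun h 1
  obtain ⟨n, ⟨d, hdv⟩, h⟩ := HeightOneSpectrum.exists_primeCompl_mul_eq_or_mul_eq v (b / a)
  have hd0 : algebraMap (𝓞 K) K d ≠ 0 := by
    rw [map_ne_zero_iff _ (FaithfulSMul.algebraMap_injective (𝓞 K) K)]
    rintro rfl
    exact hdv (zero_mem _)
  rcases h with h | h
  · refine ⟨a / algebraMap (𝓞 K) K d, ![d, n], div_ne_zero ha hd0, by simp [hd0], ?_,
      fun h0 => hdv (Ideal.Quotient.eq_zero_iff_mem.mp (congrFun h0 0))⟩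
    simp only [Matrix.cons_val_one, Matrix.cons_val_fin_one, ← h]
    field_simp
  · have hn0 : algebraMap (𝓞 K) K n ≠ 0 := by
      intro hn
      rw [hn, mul_zero] at h
      exact hd0 h.symm
    refine ⟨a / algebraMap (𝓞 K) K n, ![n, d], div_ne_zero ha hn0, by simp [hn0], ?_,
      fun h0 => hdv (Ideal.Quotient.eq_zero_iff_mem.mp (congrFun h0 1))⟩
    simp only [Matrix.cons_val_one, Matrix.cons_val_fin_one, ← h]
    field_simp

/-- The reduction map is computed by any representative primitive at `v`. -/
theorem redMap_mk (v : HeightOneSpectrum (𝓞 K)) (w : Fin 2 → 𝓞 K)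
    (hw : (fun i => algebraMap (𝓞 K) K (w i)) ≠ 0)
    (hw' : (fun i => Ideal.Quotient.mk v.asIdeal (w i)) ≠ 0) :
    redMap v (Projectivization.mk K _ hw) =
      Projectivization.mk (𝓞 K ⧸ v.asIdeal) (fun i => Ideal.Quotient.mk v.asIdeal (w i)) hw' := by
  have h : ∃ y : ℙ (𝓞 K ⧸ v.asIdeal) (Fin 2 → 𝓞 K ⧸ v.asIdeal),
      ∃ (u : Fin 2 → 𝓞 K) (hu : (fun i => algebraMap (𝓞 K) K (u i)) ≠ 0)
        (hu' : (fun i => Ideal.Quotient.mk v.asIdeal (u i)) ≠ 0),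
      Projectivization.mk K _ hw = Projectivization.mk K (fun i => algebraMap (𝓞 K) K (u i)) hu ∧
      y = Projectivization.mk (𝓞 K ⧸ v.asIdeal)
        (fun i => Ideal.Quotient.mk v.asIdeal (u i)) hu' :=
    ⟨_, w, hw, hw', rfl, rfl⟩
  obtain ⟨u, hu, hu', h1, h2⟩ := h.choose_spec
  rw [redMap, dif_pos h, h2, projLine_mk_eq_mk_iff]
  rw [projLine_mk_eq_mk_iff] at h1
  have h3 : w 0 * u 1 = u 0 * w 1 :=
    FaithfulSMul.algebraMap_injective (𝓞 K) K (by simpa only [map_mul] using h1)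
  rw [← map_mul, ← map_mul, ← h3]

/-- If two points of `ℙ¹(K)` have distinct reductions at `v`, then the valuation at `v` of the
determinant of representatives dominates that of any product of their coordinates. -/
theorem valuation_mul_le_valuation_det (v : HeightOneSpectrum (𝓞 K)) {a a' : Fin 2 → K}
    (ha : a ≠ 0) (ha' : a' ≠ 0)
    (hne : redMap v (Projectivization.mk K a ha) ≠ redMap v (Projectivization.mk K a' ha'))
    (i j : Fin 2) :
    v.valuation K (a i * a' j) ≤ v.valuation K (a 0 * a' 1 - a' 0 * a 1) := by
  have key : ∀ {a : Fin 2 → K} (ha : a ≠ 0), ∃ (l : K) (w : Fin 2 → 𝓞 K)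
      (hw : (fun i => Ideal.Quotient.mk v.asIdeal (w i)) ≠ 0),
      (∀ i, a i = l * algebraMap (𝓞 K) K (w i)) ∧
      redMap v (Projectivization.mk K a ha) = Projectivization.mk (𝓞 K ⧸ v.asIdeal) _ hw := by
    intro a ha
    have haa : ![a 0, a 1] ≠ 0 := by
      rwa [show ![a 0, a 1] = a by ext i; fin_cases i <;> rfl]
    obtain ⟨l, w, -, h0, h1, hw⟩ := exists_eq_mul_primitive v haa
    have hw0 : (fun i => algebraMap (𝓞 K) K (w i)) ≠ 0 := by
      intro h
      exact ha (by ext i; fin_cases i <;> simp [h0, h1, congrFun h 0, congrFun h 1])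
    refine ⟨l, w, hw, Fin.forall_fin_two.mpr ⟨h0, h1⟩, ?_⟩
    rw [← redMap_mk v w hw0 hw]
    congr 1
    rw [projLine_mk_eq_mk_iff, h0, h1]
    ring
  obtain ⟨l, w, hw, hl, hr⟩ := key ha
  obtain ⟨l', w', hw', hl', hr'⟩ := key ha'
  rw [hr, hr', Ne, projLine_mk_eq_mk_iff, ← map_mul, ← map_mul, Ideal.Quotient.eq] at hne
  have hdet : a 0 * a' 1 - a' 0 * a 1 =
      l * l' * algebraMap (𝓞 K) K (w 0 * w' 1 - w' 0 * w 1) := by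
    simp only [hl, hl', map_sub, map_mul]
    ring
  have hprod : a i * a' j = l * l' * algebraMap (𝓞 K) K (w i * w' j) := by
    simp only [hl, hl', map_mul]
    ring
  rw [hdet, hprod, map_mul, map_mul _ (l * l') (algebraMap (𝓞 K) K (w 0 * w' 1 - w' 0 * w 1)),
    (v.valuation_eq_one_iff_notMem (K := K)).mpr hne]
  exact mul_le_mul_right (v.valuation_le_one _) _

/-- If all products of coordinates are divisible by the determinant, then the ideals generated by
the coordinates have product generated by the determinant. -/
theorem span_pair_mul_span_pair_eq_span_det {R : Type*} [CommRing R] {a b a' b' : R}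
    (h00 : a * b' - a' * b ∣ a * a') (h01 : a * b' - a' * b ∣ a * b')
    (h10 : a * b' - a' * b ∣ b * a') (h11 : a * b' - a' * b ∣ b * b') :
    Ideal.span {a, b} * Ideal.span {a', b'} = Ideal.span {a * b' - a' * b} := by
  apply le_antisymm
  · rw [Ideal.span_pair_mul_span_pair, Ideal.span_le]
    rintro x (rfl | rfl | rfl | rfl) <;> simpa [Ideal.mem_span_singleton]
  · rw [Ideal.span_singleton_le_iff_mem, mul_comm a' b]
    exact sub_mem
      (Ideal.mul_mem_mul (Ideal.subset_span (by simp)) (Ideal.subset_span (by simp)))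
      (Ideal.mul_mem_mul (Ideal.subset_span (by simp)) (Ideal.subset_span (by simp)))

/-- The coefficients of the product of two scaled linear forms lie in any subring containing the
three coefficients of the resulting quadratic form. -/
theorem coeff_mul_linear_forms_mem {F : Type*} [Field F] (R : Subring F) {c a b a' b' : F}
    (h0 : c * (b * b') ∈ R) (h1 : c * (b * a' + a * b') ∈ R) (h2 : c * (a * a') ∈ R)
    (m : Fin 2 →₀ ℕ) :
    (MvPolynomial.C c * ((MvPolynomial.C b * MvPolynomial.X 0 - MvPolynomial.C a * MvPolynomial.X 1) *
      (MvPolynomial.C b' * MvPolynomial.X 0 - MvPolynomial.C a' * MvPolynomial.X 1)) :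
        MvPolynomial (Fin 2) F).coeff m ∈ R := by
  have h : (MvPolynomial.C c * ((MvPolynomial.C b * MvPolynomial.X 0 -
      MvPolynomial.C a * MvPolynomial.X 1) *
      (MvPolynomial.C b' * MvPolynomial.X 0 - MvPolynomial.C a' * MvPolynomial.X 1)) :
        MvPolynomial (Fin 2) F) =
      MvPolynomial.map R.subtype (MvPolynomial.C ⟨_, h0⟩ * MvPolynomial.X 0 ^ 2 -
        MvPolynomial.C ⟨_, h1⟩ * (MvPolynomial.X 0 * MvPolynomial.X 1) +
        MvPolynomial.C ⟨_, h2⟩ * MvPolynomial.X 1 ^ 2) := by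
    simp only [map_add, map_sub, map_mul, map_pow, MvPolynomial.map_C, MvPolynomial.map_X,
      Subring.subtype_apply]
    ring
  rw [h, MvPolynomial.coeff_map]
  exact Subtype.property _

/-- Let `α, β, α', β' ∈ 𝒪_{K,S}` with `d = αβ' − α'β ≠ 0`, and
suppose `A = {[α:β], [α':β']} ∈ Ω_{2,K}(ℙ¹;S)`. Then
`(α𝒪 + β𝒪)(α'𝒪 + β'𝒪) = d𝒪` in `𝒪 = 𝒪_{K,S}`; consequently the binary quadratic
form `φ_A(x,y) = d⁻¹(βx − αy)(β'x − α'y)` has all coefficients in `𝒪_{K,S}` and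
discriminant `Δ(φ_A) = (d⁻¹)²(αβ' − α'β)² = 1`. -/
theorem span_mul_span_eq_span_det_of_mem_Omega
    (S : Finset (HeightOneSpectrum (𝓞 K)))
    (α β α' β' : ↥((S : Set (HeightOneSpectrum (𝓞 K))).integer K))
    (hd : α * β' - α' * β ≠ 0)
    (hA : ({Projectivization.mk K ![(α : K), (β : K)] (by
        intro h0
        apply hd
        have h1 : (α : K) = 0 := by simpa using congrFun h0 0
        have h2 : (β : K) = 0 := by simpa using congrFun h0 1
        have h1' : α = 0 := by exact_mod_cast h1
        have h2' : β = 0 := by exact_mod_cast h2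
        rw [h1', h2']; ring),
      Projectivization.mk K ![(α' : K), (β' : K)] (by
        intro h0
        apply hd
        have h1 : (α' : K) = 0 := by simpa using congrFun h0 0
        have h2 : (β' : K) = 0 := by simpa using congrFun h0 1
        have h1' : α' = 0 := by exact_mod_cast h1
        have h2' : β' = 0 := by exact_mod_cast h2
        rw [h1', h2']; ring)} : Set (ℙ K (Fin 2 → K))) ∈ OmegaSet S 2) :
    Ideal.span {α, β} * Ideal.span {α', β'} = Ideal.span {α * β' - α' * β} ∧
    (∀ m : Fin 2 →₀ ℕ,
      ((MvPolynomial.C (((α * β' - α' * β : ↥((S : Set (HeightOneSpectrum (𝓞 K))).integer K)) : K))⁻¹ *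
        ((MvPolynomial.C (β : K) * MvPolynomial.X 0 - MvPolynomial.C (α : K) * MvPolynomial.X 1) *
          (MvPolynomial.C (β' : K) * MvPolynomial.X 0 - MvPolynomial.C (α' : K) * MvPolynomial.X 1)) :
        MvPolynomial (Fin 2) K)).coeff m
        ∈ (S : Set (HeightOneSpectrum (𝓞 K))).integer K) ∧
    (((α * β' - α' * β : ↥((S : Set (HeightOneSpectrum (𝓞 K))).integer K)) : K))⁻¹ ^ 2 *
        ((α : K) * (β' : K) - (α' : K) * (β : K)) ^ 2 = 1 := by
  have hdK : (α : K) * β' - α' * β ≠ 0 := by exact_mod_cast hd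
  have hα : ![(α : K), (β : K)] ≠ 0 := fun h0 => hdK (by
    have h1 : (α : K) = 0 := by simpa using congrFun h0 0
    have h2 : (β : K) = 0 := by simpa using congrFun h0 1
    simp [h1, h2])
  have hα' : ![(α' : K), (β' : K)] ≠ 0 := fun h0 => hdK (by
    have h1 : (α' : K) = 0 := by simpa using congrFun h0 0
    have h2 : (β' : K) = 0 := by simpa using congrFun h0 1
    simp [h1, h2])
  have hquot : ∀ i j : Fin 2, ((α : K) * β' - α' * β)⁻¹ *
      (![(α : K), (β : K)] i * ![(α' : K), (β' : K)] j) ∈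
        (S : Set (HeightOneSpectrum (𝓞 K))).integer K := by
    intro i j v hv
    have hne : redMap v (Projectivization.mk K _ hα) ≠ redMap v (Projectivization.mk K _ hα') := by
      intro h
      have := hA.2.2 v hv (Set.mem_insert _ _) (Set.mem_insert_of_mem _ rfl) h
      rw [projLine_mk_eq_mk_iff] at this
      exact hdK (sub_eq_zero.mpr (by simpa using this))
    have hle := valuation_mul_le_valuation_det v hα hα' hne i j
    have hpos : 0 < v.valuation K ((α : K) * β' - α' * β) :=
      zero_lt_iff.mpr ((Valuation.ne_zero_iff _).mpr hdK)
    rw [map_mul, map_inv₀, inv_mul_le_iff₀ hpos, mul_one]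
    simpa using hle
  have hdvd : ∀ x y : ↥((S : Set (HeightOneSpectrum (𝓞 K))).integer K),
      ((α : K) * β' - α' * β)⁻¹ * ((x : K) * y) ∈ (S : Set (HeightOneSpectrum (𝓞 K))).integer K →
      α * β' - α' * β ∣ x * y := by
    intro x y h
    refine ⟨⟨_, h⟩, Subtype.ext ?_⟩
    push_cast
    rw [mul_inv_cancel_left₀ hdK]
  refine ⟨span_pair_mul_span_pair_eq_span_det (hdvd _ _ (hquot 0 0)) (hdvd _ _ (hquot 0 1))
    (hdvd _ _ (hquot 1 0)) (hdvd _ _ (hquot 1 1)), ?_, ?_⟩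
  · refine coeff_mul_linear_forms_mem
      ((S : Set (HeightOneSpectrum (𝓞 K))).integer K).toSubring (hquot 1 1) ?_ (hquot 0 0)
    rw [mul_add]
    exact add_mem (hquot 1 0) (hquot 0 1)
  · rw [← mul_pow]
    push_cast
    rw [inv_mul_cancel₀ hdK, one_pow]
end

section
/- Let G be a finite group of order n, and let A be an abelian group equipped with an action of G by group automorphisms. If A is torsion-free and the quotient A/nA is finite, then the first cohomology group H¹(G,A) is finite. -/
/-- The subgroup `n·A` of an abelian group `A`. -/
def smulSubgroup (n : ℤ) (A : Type*) [AddCommGroup A] : AddSubgroup A where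
  carrier := Set.range fun a : A => n • a
  zero_mem' := ⟨0, by simp⟩
  add_mem' := by rintro _ _ ⟨a, rfl⟩ ⟨b, rfl⟩; exact ⟨a + b, by simp [smul_add]⟩
  neg_mem' := by rintro _ ⟨a, rfl⟩; exact ⟨-a, by simp⟩

/-- 1-cocycles of `G` with values in the `G`-module `A` (additive notation):
`f(στ) = f(σ) + σ·f(τ)`. -/
def IsAddCocycle {G A : Type*} [Group G] [AddCommGroup A] [DistribMulAction G A]
    (f : G → A) : Prop :=
  ∀ σ τ : G, f (σ * τ) = f σ + σ • f τ

/-- Two 1-cocycles are cohomologous iff they differ by the 1-coboundary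
`σ ↦ σ·c − c` of some `c ∈ A`; `H¹(G,A)` is the quotient by this relation. -/
def AddCohomologous {G A : Type*} [Group G] [AddCommGroup A] [DistribMulAction G A]
    (f g : G → A) : Prop :=
  ∃ c : A, ∀ σ : G, g σ = f σ + (σ • c - c)

/-- Multiplying a 1-cocycle by the order of `G` gives the coboundary of minus the sum of its
values. -/
theorem IsAddCocycle.card_nsmul_apply {G A : Type*} [Group G] [Fintype G] [AddCommGroup A]
    [DistribMulAction G A] {f : G → A} (hf : IsAddCocycle f) (σ : G) :
    Nat.card G • f σ = (∑ τ, f τ) - σ • ∑ τ, f τ := by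
  have h : ∑ τ, f (σ * τ) = ∑ τ, f τ := Equiv.sum_comp (Equiv.mulLeft σ) f
  simp only [hf σ, Finset.sum_add_distrib, Finset.sum_const, Finset.card_univ,
    ← Finset.smul_sum] at h
  rw [Nat.card_eq_fintype_card, eq_sub_iff_add_eq, h]

/-- For torsion-free coefficients, 1-cocycles whose sums agree modulo the order of `G` are
cohomologous. -/
theorem IsAddCocycle.addCohomologous_of_sum_sub_sum {G A : Type*} [Group G] [Fintype G]
    [AddCommGroup A] [DistribMulAction G A]
    (htf : ∀ (a : A) (m : ℕ), 0 < m → m • a = 0 → a = 0)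
    {f g : G → A} (hf : IsAddCocycle f) (hg : IsAddCocycle g) {c : A}
    (hc : Nat.card G • c = (∑ τ, g τ) - ∑ τ, f τ) : AddCohomologous f g := by
  refine ⟨-c, fun σ => ?_⟩
  rw [← sub_eq_zero]
  refine htf _ (Nat.card G) Nat.card_pos ?_
  have hσ : Nat.card G • σ • c = σ • (∑ τ, g τ) - σ • ∑ τ, f τ := by
    rw [← smul_sub, ← hc, smul_comm]
  simp only [smul_neg, smul_sub, smul_add, hf.card_nsmul_apply, hg.card_nsmul_apply, hσ, hc]
  abel

/-- If `G` is a finite group of order `n` and `A` is a torsion-free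
`G`-module with `A/nA` finite, then `H¹(G,A)` is finite. -/
theorem finite_H1_of_torsionFree_of_finite_quotient
    (G : Type*) [Group G] [Finite G] (n : ℕ) (hn : Nat.card G = n)
    (A : Type*) [AddCommGroup A] [DistribMulAction G A]
    (htf : ∀ (a : A) (m : ℕ), 0 < m → m • a = 0 → a = 0)
    (hfin : Finite (A ⧸ smulSubgroup (n : ℤ) A)) :
    Finite (Quot fun f g : {f : G → A // IsAddCocycle f} => AddCohomologous f.1 g.1) := by
  cases nonempty_fintype G
  subst hn
  refine Finite.of_injective
    (fun q => (QuotientAddGroup.mk (∑ τ, q.out.1 τ) : A ⧸ smulSubgroup (Nat.card G : ℤ) A)) ?_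
  intro p q hpq
  obtain ⟨c, hc⟩ := QuotientAddGroup.eq.mp hpq
  rw [← p.out_eq, ← q.out_eq]
  refine Quot.sound (p.out.2.addCohomologous_of_sum_sub_sum htf q.out.2 (c := c) ?_)
  rw [← natCast_zsmul, sub_eq_neg_add]
  exact hc
end

section
/- Let G be a finite group, let B be a G-group, and let A be a G-stable normal subgroup of B such that A is abelian, torsion-free, and A/|G|A is finite, where |G| is the order of G. Endow C = B/A with the induced G-action. If the pointed set H¹(G,C) is finite, then H¹(G,B) is finite. -/
section

variable {G B : Type*} [Group G] [Group B] [MulDistribMulAction G B]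

/-- 1-cocycles of `G` with values in the `G`-group `B`: `f(στ) = f(σ)·σ(f(τ))`. -/
def IsMulCocycle (f : G → B) : Prop :=
  ∀ σ τ : G, f (σ * τ) = f σ * σ • f τ

/-- Two 1-cocycles are cohomologous iff `g(σ) = c⁻¹·f(σ)·σ(c)` for some `c ∈ B`;
`H¹(G,B)` is the (pointed) set of classes of 1-cocycles for this relation. -/
def MulCohomologous (f g : G → B) : Prop :=
  ∃ c : B, ∀ σ : G, g σ = c⁻¹ * f σ * σ • c

/-- 1-cocycles of `G` with values in the quotient `C = B/A` of `B` by a `G`-stable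
normal subgroup `A`, presented by functions with values in `B`. -/
def IsMulCocycleMod (A : Subgroup B) (f : G → B) : Prop :=
  ∀ σ τ : G, (f (σ * τ))⁻¹ * (f σ * σ • f τ) ∈ A

/-- The cohomology relation for the quotient `C = B/A`, presented at the level
of `B`: the classes of `f` and `g` in `H¹(G, B/A)` coincide. -/
def MulCohomologousMod (A : Subgroup B) (f g : G → B) : Prop :=
  ∃ c : B, ∀ σ : G, (g σ)⁻¹ * (c⁻¹ * f σ * σ • c) ∈ A

end

section

variable {G B : Type*} [Group G] [Group B] [MulDistribMulAction G B]

theorem IsMulCocycle.isMulCocycleMod {f : G → B} (hf : IsMulCocycle f) (A : Subgroup B) :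
    IsMulCocycleMod A f := fun σ τ => by
  rw [← hf σ τ, inv_mul_cancel]
  exact A.one_mem

theorem IsMulCocycle.conj {f : G → B} (hf : IsMulCocycle f) (c : B) :
    IsMulCocycle fun σ => c⁻¹ * f σ * σ • c := fun σ τ => by
  simp only [hf σ τ, smul_mul', smul_inv', mul_smul]
  group

theorem mulCohomologousMod_iff (A : Subgroup B) [A.Normal] (f g : G → B) :
    MulCohomologousMod A f g ↔
      ∃ c : B, ∀ σ : G, (g σ : B ⧸ A) = (c : B ⧸ A)⁻¹ * (f σ : B ⧸ A) * ((σ • c : B) : B ⧸ A) := by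
  refine exists_congr fun c => forall_congr' fun σ => ?_
  rw [← QuotientGroup.eq]
  rfl

theorem equivalence_mulCohomologousMod (A : Subgroup B) [A.Normal] :
    Equivalence (MulCohomologousMod (G := G) A) where
  refl f := (mulCohomologousMod_iff A f f).2 ⟨1, fun σ => by simp⟩
  symm {f g} h := by
    rw [mulCohomologousMod_iff] at h ⊢
    obtain ⟨c, hc⟩ := h
    refine ⟨c⁻¹, fun σ => ?_⟩
    rw [hc, smul_inv', QuotientGroup.mk_inv, QuotientGroup.mk_inv]
    group
  trans {f g h} hfg hgh := by
    rw [mulCohomologousMod_iff] at hfg hgh ⊢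
    obtain ⟨c, hc⟩ := hfg
    obtain ⟨d, hd⟩ := hgh
    refine ⟨c * d, fun σ => ?_⟩
    rw [hd, hc, smul_mul', QuotientGroup.mk_mul, QuotientGroup.mk_mul]
    group

/-- The action of `σ` on a `G`-stable normal subgroup `A`, twisted by conjugation by `b`. -/
def twistedAction (A : Subgroup B) [A.Normal] (hstable : ∀ (σ : G) (b : B), b ∈ A → σ • b ∈ A)
    (b : B) (σ : G) : A →* A where
  toFun a := ⟨b * σ • (a : B) * b⁻¹, ‹A.Normal›.conj_mem _ (hstable σ a a.2) b⟩
  map_one' := by ext; simp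
  map_mul' x y := by ext; simp [smul_mul']

end

/-- A cocycle raised to the power `|G|` is the coboundary of the product of its values, so in a
torsion-free abelian group this product modulo `|G|`-th powers determines its class. -/
theorem eq_mul_div_of_prod_eq {G A : Type*} [Group G] [Fintype G] [CommGroup A]
    (htf : ∀ (a : A) (m : ℕ), 0 < m → a ^ m = 1 → a = 1) (θ : G → A →* A) {a b : G → A}
    (ha : ∀ σ τ, a (σ * τ) = a σ * θ σ (a τ)) (hb : ∀ σ τ, b (σ * τ) = b σ * θ σ (b τ))
    {t : A} (ht : ∏ σ, b σ = (∏ σ, a σ) * t ^ Nat.card G) (σ : G) :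
    b σ = a σ * (t / θ σ t) := by
  have key : ∀ f : G → A, (∀ σ τ, f (σ * τ) = f σ * θ σ (f τ)) →
      ∏ τ, f τ = f σ ^ Nat.card G * θ σ (∏ τ, f τ) := fun f hf => by
    conv_lhs => rw [← Equiv.prod_comp (Equiv.mulLeft σ) f]
    simp [hf, Finset.prod_mul_distrib, map_prod]
  have h : ∀ f : G → A, (∀ σ τ, f (σ * τ) = f σ * θ σ (f τ)) →
      f σ ^ Nat.card G = (∏ τ, f τ) / θ σ (∏ τ, f τ) := fun f hf =>
    eq_div_of_mul_eq' (key f hf).symm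
  rw [← div_eq_one]
  refine htf _ (Nat.card G) Nat.card_pos ?_
  rw [div_pow, mul_pow, div_pow, h b hb, h a ha, ht, map_mul, map_pow, div_eq_one,
    mul_div_mul_comm]

theorem Finite.quot_of_map {X Y : Type*} [Finite Y] {r : X → X → Prop} (φ : X → Y)
    (h : ∀ x y, φ x = φ y → r x y) : Finite (Quot r) :=
  Finite.of_injective (fun q : Quot r => φ q.out) fun p q hpq => by
    rw [← Quot.out_eq p, ← Quot.out_eq q]
    exact Quot.sound (h _ _ hpq)

theorem exists_eq_mul_pow_of_mk_eq {A : Type*} [CommGroup A] {n : ℕ} {x y : A}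
    (h : (x : A ⧸ Subgroup.closure {x : A | ∃ a : A, x = a ^ n}) = y) :
    ∃ t, y = x * t ^ n := by
  have hle : Subgroup.closure {x : A | ∃ a : A, x = a ^ n} ≤ (powMonoidHom n : A →* A).range := by
    rw [Subgroup.closure_le]
    rintro _ ⟨a, rfl⟩
    exact ⟨a, rfl⟩
  obtain ⟨t, ht⟩ := hle (QuotientGroup.eq.1 h)
  exact ⟨t, by rw [← powMonoidHom_apply, ht, mul_inv_cancel_left]⟩

/-- Let `G` be a finite group, `B` a `G`-group and `A` a `G`-stable
normal abelian subgroup of `B` which is torsion-free with `A/|G|A` finite. If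
`H¹(G, B/A)` is finite then `H¹(G, B)` is finite. -/
theorem finite_H1_of_extension
    (G B : Type*) [Group G] [Finite G] [Group B] [MulDistribMulAction G B]
    (A : Subgroup B) [A.Normal]
    (hstable : ∀ (σ : G) (b : B), b ∈ A → σ • b ∈ A)
    (hab : ∀ a b : ↥A, a * b = b * a)
    (htf : ∀ (a : ↥A) (m : ℕ), 0 < m → a ^ m = 1 → a = 1)
    (hfin : Finite (↥A ⧸ Subgroup.closure {x : ↥A | ∃ a : ↥A, x = a ^ Nat.card G}))
    (hC : Finite (Quot fun f g : {f : G → B // IsMulCocycleMod A f} =>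
      MulCohomologousMod A f.1 g.1)) :
    Finite (Quot fun f g : {f : G → B // IsMulCocycle f} => MulCohomologous f.1 g.1) := by
  let _ : Fintype G := Fintype.ofFinite G
  let _ : CommGroup A := { (inferInstance : Group A) with mul_comm := hab }
  let q : {f : G → B // IsMulCocycle f} →
      Quot fun f g : {f : G → B // IsMulCocycleMod A f} => MulCohomologousMod A f.1 g.1 :=
    fun f => Quot.mk _ ⟨f.1, f.2.isMulCocycleMod A⟩
  let rep := fun f => Set.rangeSplitting q ⟨q f, f, rfl⟩
  have hrep : ∀ f, MulCohomologousMod A f.1 (rep f).1 := fun f => by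
    have h : q f = q (rep f) := (Set.apply_rangeSplitting q ⟨q f, f, rfl⟩).symm
    exact (((equivalence_mulCohomologousMod A).comap
      (Subtype.val : {f : G → B // IsMulCocycleMod A f} → G → B)).quot_mk_eq_iff _ _).1 h
  have hex : ∀ f, ∃ (c : B) (a : G → A),
      ∀ σ, c⁻¹ * f.1 σ * σ • c = a σ * (rep f).1 σ := fun f => by
    obtain ⟨c, hc⟩ := hrep f
    exact ⟨c, fun σ => ⟨_, ‹A.Normal›.conj_mem _ (hc σ) ((rep f).1 σ)⟩, fun σ => by group⟩
  choose c a hca using hex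
  let θ := fun f σ => twistedAction A hstable ((rep f).1 σ) σ
  have ha : ∀ f σ τ, a f (σ * τ) = a f σ * θ f σ (a f τ) := fun f σ τ => by
    have h := f.2.conj (c f) σ τ
    simp only [hca] at h
    rw [(rep f).2 σ τ, smul_mul'] at h
    ext
    rw [← mul_left_inj ((rep f).1 σ * σ • (rep f).1 τ), h]
    simp [θ, twistedAction, mul_assoc]
  refine Finite.quot_of_map (fun f => (q f, (QuotientGroup.mk (∏ σ, a f σ) :
    A ⧸ Subgroup.closure {x : A | ∃ a : A, x = a ^ Nat.card G}))) fun f g hfg => ?_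
  obtain ⟨hq, hs⟩ := Prod.ext_iff.1 hfg
  obtain ⟨t, ht⟩ := exists_eq_mul_pow_of_mk_eq hs
  have hfg_rep : rep g = rep f := by simp only [rep, show q f = q g from hq]
  have hb := ha g
  simp only [θ, hfg_rep] at hb
  refine ⟨c f * (t : B)⁻¹ * (c g)⁻¹, fun σ => ?_⟩
  have h := eq_mul_div_of_prod_eq htf (θ f) (ha f) hb ht σ
  rw [← mul_div_assoc, mul_comm (a f σ) t] at h
  have hval : (a g σ : B) = t * a f σ * ((rep f).1 σ * σ • (t : B) * ((rep f).1 σ)⁻¹)⁻¹ :=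
    congrArg Subtype.val (h.trans (div_eq_mul_inv _ _))
  have hg := hca g σ
  rw [hfg_rep, hval] at hg
  have hf : (a f σ : B) = (c f)⁻¹ * f.1 σ * σ • c f * ((rep f).1 σ)⁻¹ := by
    rw [hca f σ, mul_inv_cancel_right]
  rw [hf] at hg
  have hg' : g.1 σ = c g * ((c g)⁻¹ * g.1 σ * σ • c g) * (σ • c g)⁻¹ := by group
  rw [hg', hg]
  simp only [smul_mul', smul_inv']
  group
end

section
/- Let n ≥ 2 and let f(x,y) = a ∏_{i=1}^n (β_i x − α_i y) with a ∈ O_{K,S} \ {0} and α_i, β_i ∈ O_{K,S}, such that the n points [α_i:β_i] ∈ ℙ¹(K) are pairwise distinct. If Δ(f) ∈ O_{K,S}^×, then for every maximal ideal p of O_K with p ∉ S the reductions r_p([α_1:β_1]),…,r_p([α_n:β_n]) ∈ ℙ¹(O_K/p) are pairwise distinct; consequently the set {[α_1:β_1],…,[α_n:β_n]} belongs to Ω_{n,K}(ℙ¹;S). -/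
open Classical IsDedekindDomain NumberField
open scoped LinearAlgebra.Projectivization MatrixGroups

attribute [local instance] Ideal.Quotient.field

set_option synthInstance.maxHeartbeats 1000000
set_option maxHeartbeats 1000000

variable {K : Type*} [Field K] [NumberField K]

/-- A pair of `v`-integral coordinates, one of them a `v`-unit, computes the reduction up to
scaling by a `v`-unit. -/
lemma exists_redMap_mk_eq (v : HeightOneSpectrum (𝓞 K)) {x y : K} (h : ![x, y] ≠ 0)
    (hx : v.valuation K x ≤ 1) (hy : v.valuation K y ≤ 1)
    (hxy : v.valuation K x = 1 ∨ v.valuation K y = 1) :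
    ∃ (w : Fin 2 → 𝓞 K) (c : K) (hw : (fun i => Ideal.Quotient.mk v.asIdeal (w i)) ≠ 0),
      v.valuation K c = 1 ∧ algebraMap (𝓞 K) K (w 0) = c * x ∧
      algebraMap (𝓞 K) K (w 1) = c * y ∧
      redMap v (Projectivization.mk K ![x, y] h) =
        Projectivization.mk (𝓞 K ⧸ v.asIdeal)
          (fun i => Ideal.Quotient.mk v.asIdeal (w i)) hw := by
  have hex : ∃ z : ℙ (𝓞 K ⧸ v.asIdeal) (Fin 2 → 𝓞 K ⧸ v.asIdeal),
      ∃ (w : Fin 2 → 𝓞 K) (hw : (fun i => algebraMap (𝓞 K) K (w i)) ≠ 0)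
        (hw' : (fun i => Ideal.Quotient.mk v.asIdeal (w i)) ≠ 0),
      Projectivization.mk K ![x, y] h =
        Projectivization.mk K (fun i => algebraMap (𝓞 K) K (w i)) hw ∧
      z = Projectivization.mk (𝓞 K ⧸ v.asIdeal)
        (fun i => Ideal.Quotient.mk v.asIdeal (w i)) hw' := by
    obtain ⟨r, s, hr⟩ := v.exists_primeCompl_mul_eq_of_integer x hx
    obtain ⟨t, u, ht⟩ := v.exists_primeCompl_mul_eq_of_integer y hy
    have hs1 := (v.valuation_eq_one_iff_notMem (K := K)).2 s.2
    have hu1 := (v.valuation_eq_one_iff_notMem (K := K)).2 u.2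
    have hs0 : algebraMap (𝓞 K) K s ≠ 0 := fun h0 => by simp [h0] at hs1
    have hu0 : algebraMap (𝓞 K) K u ≠ 0 := fun h0 => by simp [h0] at hu1
    set w : Fin 2 → 𝓞 K := ![r * u, t * s]
    have hsmul : (algebraMap (𝓞 K) K s * algebraMap (𝓞 K) K u) • ![x, y] =
        fun i => algebraMap (𝓞 K) K (w i) := by
      funext i
      fin_cases i
      · simp [w, ← hr]; ring
      · simp [w, ← ht]; ring
    have hw : (fun i => algebraMap (𝓞 K) K (w i)) ≠ 0 := by
      rw [← hsmul]
      exact smul_ne_zero (mul_ne_zero hs0 hu0) h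
    have hval : ∀ i, v.valuation K (algebraMap (𝓞 K) K (w i)) = v.valuation K (![x, y] i) := by
      intro i
      rw [← congrFun hsmul i]
      simp [hs1, hu1]
    refine ⟨_, w, hw, fun h0 => ?_,
      ((Projectivization.mk_eq_mk_iff' K _ _ _ _).2 ⟨_, hsmul⟩).symm, rfl⟩
    have hlt : ∀ i, v.valuation K (![x, y] i) < 1 := fun i => by
      rw [← hval i, v.valuation_lt_one_iff_mem]
      exact Ideal.Quotient.eq_zero_iff_mem.1 (congrFun h0 i)
    rcases hxy with hxy | hxy
    · exact (hlt 0).ne hxy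
    · exact (hlt 1).ne hxy
  obtain ⟨w, hw, hw', hmk, hred⟩ := hex.choose_spec
  obtain ⟨c, hc⟩ := (Projectivization.mk_eq_mk_iff' K _ _ _ _).1 hmk.symm
  have hw0 : algebraMap (𝓞 K) K (w 0) = c * x := (congrFun hc 0).symm
  have hw1 : algebraMap (𝓞 K) K (w 1) = c * y := (congrFun hc 1).symm
  refine ⟨w, c, hw', le_antisymm ?_ ?_, hw0, hw1, ?_⟩
  · rcases hxy with hxy | hxy
    · simpa [hw0, hxy] using v.valuation_le_one (K := K) (w 0)
    · simpa [hw1, hxy] using v.valuation_le_one (K := K) (w 1)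
  · obtain ⟨i, hi⟩ := Function.ne_iff.1 hw'
    have hi1 : v.valuation K (algebraMap (𝓞 K) K (w i)) = 1 :=
      v.valuation_eq_one_iff_notMem.2 fun hm => hi (Ideal.Quotient.eq_zero_iff_mem.2 hm)
    rw [← hi1, ← congrFun hc i]
    have hle : v.valuation K (![x, y] i) ≤ 1 := by fin_cases i <;> assumption
    simpa using mul_le_of_le_one_right' hle
  · rw [redMap, dif_pos hex]
    exact hred

/-- Points whose `v`-integral coordinates have a `v`-unit determinant have distinct reductions. -/
lemma redMap_mk_ne_of_valuation_det_eq_one (v : HeightOneSpectrum (𝓞 K)) {x y x' y' : K}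
    (h : ![x, y] ≠ 0) (h' : ![x', y'] ≠ 0)
    (hx : v.valuation K x ≤ 1) (hy : v.valuation K y ≤ 1)
    (hx' : v.valuation K x' ≤ 1) (hy' : v.valuation K y' ≤ 1)
    (hdet : v.valuation K (x * y' - x' * y) = 1) :
    redMap v (Projectivization.mk K ![x, y] h) ≠
      redMap v (Projectivization.mk K ![x', y'] h') := by
  have hmax : 1 ≤ max (v.valuation K x * v.valuation K y')
      (v.valuation K x' * v.valuation K y) := by
    simpa [hdet] using (v.valuation K).map_sub (x * y') (x' * y)
  have hxy : v.valuation K x = 1 ∨ v.valuation K y = 1 := by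
    rcases le_max_iff.1 hmax with h1 | h1
    · exact .inl (le_antisymm hx (h1.trans (mul_le_of_le_one_right' hy')))
    · exact .inr (le_antisymm hy (h1.trans (mul_le_of_le_one_left' hx')))
  have hxy' : v.valuation K x' = 1 ∨ v.valuation K y' = 1 := by
    rcases le_max_iff.1 hmax with h1 | h1
    · exact .inr (le_antisymm hy' (h1.trans (mul_le_of_le_one_left' hx)))
    · exact .inl (le_antisymm hx' (h1.trans (mul_le_of_le_one_right' hy)))
  obtain ⟨w, c, hw, hc, hw0, hw1, hred⟩ := exists_redMap_mk_eq v h hx hy hxy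
  obtain ⟨w', c', hw', hc', hw0', hw1', hred'⟩ := exists_redMap_mk_eq v h' hx' hy' hxy'
  rw [hred, hred']
  intro heq
  obtain ⟨b, hb⟩ := (Projectivization.mk_eq_mk_iff' _ _ _ _ _).1 heq
  have hb0 : b * Ideal.Quotient.mk v.asIdeal (w' 0) = Ideal.Quotient.mk v.asIdeal (w 0) :=
    congrFun hb 0
  have hb1 : b * Ideal.Quotient.mk v.asIdeal (w' 1) = Ideal.Quotient.mk v.asIdeal (w 1) :=
    congrFun hb 1
  have hmem : w 0 * w' 1 - w' 0 * w 1 ∈ v.asIdeal := by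
    rw [← Ideal.Quotient.eq_zero_iff_mem, map_sub, map_mul, map_mul, ← hb0, ← hb1]
    ring
  have hlt : v.valuation K (algebraMap (𝓞 K) K (w 0 * w' 1 - w' 0 * w 1)) < 1 :=
    (v.valuation_lt_one_iff_mem _).2 hmem
  have hcalc : algebraMap (𝓞 K) K (w 0 * w' 1 - w' 0 * w 1) =
      c * c' * (x * y' - x' * y) := by
    rw [map_sub, map_mul, map_mul, hw0, hw1, hw0', hw1']
    ring
  rw [hcalc, map_mul, map_mul, hc, hc', hdet] at hlt
  simp at hlt

/-- Units of the ring of `S`-integers have valuation one away from `S`. -/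
lemma valuation_eq_one_of_isUnit_integer {S : Set (HeightOneSpectrum (𝓞 K))}
    {x : S.integer K} (hx : IsUnit x) {v : HeightOneSpectrum (𝓞 K)} (hv : v ∉ S) :
    v.valuation K (x : K) = 1 := by
  obtain ⟨y, hy⟩ := hx.exists_right_inv
  have hmul : v.valuation K (x : K) * v.valuation K (y : K) = 1 := by
    rw [← map_mul, ← map_one (v.valuation K)]
    exact congrArg (fun z : S.integer K => v.valuation K (z : K)) hy
  refine le_antisymm (x.2 v hv) ?_
  rw [← hmul]
  exact mul_le_of_le_one_right' (y.2 v hv)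

/-- Let `n ≥ 2` and `f = a·∏(βᵢx − αᵢy)` with `a ∈ 𝒪_{K,S} \ {0}`,
`αᵢ, βᵢ ∈ 𝒪_{K,S}`, such that the points `[αᵢ:βᵢ] ∈ ℙ¹(K)` are pairwise distinct.
If `Δ(f) = a^(2n−2) ∏_{i<j} (αᵢβⱼ − αⱼβᵢ)²` is a unit of `𝒪_{K,S}`, then for every
maximal ideal `𝔭 ∉ S` the reductions of the points mod `𝔭` are pairwise distinct;
consequently `{[α₁:β₁],…,[αₙ:βₙ]} ∈ Ω_{n,K}(ℙ¹;S)`. -/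
theorem distinct_reductions_of_unit_disc
    (S : Finset (HeightOneSpectrum (𝓞 K))) (n : ℕ) (hn : 2 ≤ n)
    (a : ↥((S : Set (HeightOneSpectrum (𝓞 K))).integer K)) (ha : a ≠ 0)
    (α β : Fin n → ↥((S : Set (HeightOneSpectrum (𝓞 K))).integer K))
    (hne : ∀ i, ![(α i : K), (β i : K)] ≠ 0)
    (hdist : ∀ i j, i ≠ j →
      Projectivization.mk K ![(α i : K), (β i : K)] (hne i) ≠
        Projectivization.mk K ![(α j : K), (β j : K)] (hne j))
    (hΔ : IsUnit (a ^ (2 * n - 2) *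
      ∏ i : Fin n, ∏ j ∈ Finset.Ioi i, (α i * β j - α j * β i) ^ 2)) :
    (∀ v : HeightOneSpectrum (𝓞 K), v ∉ S → ∀ i j : Fin n, i ≠ j →
      redMap v (Projectivization.mk K ![(α i : K), (β i : K)] (hne i)) ≠
        redMap v (Projectivization.mk K ![(α j : K), (β j : K)] (hne j))) ∧
    {x : ℙ K (Fin 2 → K) |
        ∃ i, x = Projectivization.mk K ![(α i : K), (β i : K)] (hne i)} ∈
      OmegaSet S n := by
  have hunit : ∀ i j, i < j → IsUnit (α i * β j - α j * β i) := fun i j hij =>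
    isUnit_of_dvd_unit
      ((dvd_pow_self _ two_ne_zero).trans
        ((Finset.dvd_prod_of_mem _ (Finset.mem_Ioi.2 hij)).trans
          ((Finset.dvd_prod_of_mem
            (fun i : Fin n => ∏ j ∈ Finset.Ioi i, (α i * β j - α j * β i) ^ 2)
            (Finset.mem_univ i)).trans (dvd_mul_left _ _)))) hΔ
  have hlt : ∀ v : HeightOneSpectrum (𝓞 K), v ∉ S → ∀ i j : Fin n, i < j →
      redMap v (Projectivization.mk K ![(α i : K), (β i : K)] (hne i)) ≠
        redMap v (Projectivization.mk K ![(α j : K), (β j : K)] (hne j)) :=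
    fun v hv i j hij => redMap_mk_ne_of_valuation_det_eq_one v _ _
      ((α i).2 v hv) ((β i).2 v hv) ((α j).2 v hv) ((β j).2 v hv)
      (valuation_eq_one_of_isUnit_integer (hunit i j hij) hv)
  have hred : ∀ v : HeightOneSpectrum (𝓞 K), v ∉ S → ∀ i j : Fin n, i ≠ j →
      redMap v (Projectivization.mk K ![(α i : K), (β i : K)] (hne i)) ≠
        redMap v (Projectivization.mk K ![(α j : K), (β j : K)] (hne j)) := by
    intro v hv i j hij
    rcases hij.lt_or_gt with h | h
    · exact hlt v hv i j h
    · exact (hlt v hv j i h).symm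
  have hinj : Function.Injective
      fun i => Projectivization.mk K ![(α i : K), (β i : K)] (hne i) :=
    fun i j hij => by_contra fun h => hdist i j h hij
  have hset : {x : ℙ K (Fin 2 → K) |
      ∃ i, x = Projectivization.mk K ![(α i : K), (β i : K)] (hne i)} =
      Set.range fun i => Projectivization.mk K ![(α i : K), (β i : K)] (hne i) := by
    ext x
    simp [eq_comm]
  refine ⟨hred, hset ▸ ⟨Set.finite_range _, ?_, ?_⟩⟩
  · rw [← Set.image_univ, Set.ncard_image_of_injective _ hinj, Set.ncard_univ, Nat.card_fin]
  · rintro v hv _ ⟨i, rfl⟩ _ ⟨j, rfl⟩ hij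
    by_contra h
    exact hred v hv i j (fun e => h (e ▸ rfl)) hij
end
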